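/- arXiv:1712.08520 — 3 statements merged into one kernel-verified Lean document; each statement's English description precedes it below -/
import Mathlib

section
/- Let (S_l,S_{l−1},…,S₁,S_{l+1},…,S_k) be an ordered set partition of {1,…,n} (its blocks listed in this order). Then the function [[S_l,S_{l−1},…,S₁,S_{l+1},…,S_k]] − ∑_π (−1)^{k−l−1−len(π)} [[π]] on V₀ⁿ vanishes outside a finite union of proper linear subspaces of V₀ⁿ (in particular, it vanishes Lebesgue-almost everywhere on V₀ⁿ), where π ranges over all ordered set partitions of {1,…,n} each of whose blocks is a union of some of the sets S₁,…,S_k, such that for i = 1,…,l−1 the block containing S_{i+1} is weakly later than the block containing S_i, the block containing S₁ strictly precedes the block containing S_{l+1}, and the block containing S_i strictly precedes the block containing S_{i+1} for i = l+1,…,k−1. -/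
open scoped Pointwise Classical

namespace PlatesPaper

/-- The union of a list of finite sets. -/
def lUnion {n : ℕ} (L : List (Finset (Fin n))) : Finset (Fin n) :=
  L.foldr (· ∪ ·) ∅

/-- `L` is an ordered set partition of `J`: a list of pairwise disjoint nonempty
finite sets whose union is `J`. -/
def IsOSP {n : ℕ} (J : Finset (Fin n)) (L : List (Finset (Fin n))) : Prop :=
  (∀ B ∈ L, B.Nonempty) ∧ L.Pairwise Disjoint ∧ lUnion L = J

/-- The plate of an ordered set partition `L` (of a subset `J = lUnion L` of `{1,…,n}`):
the set of `x ∈ V₀ⁿ` vanishing outside `J`, with `x_J = 0`, and such that the partial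
sums over the unions of the first `i` blocks are nonnegative for `i = 1,…,len(L)−1`.
(For an ordered set partition of the whole of `{1,…,n}` the first two conditions are
equivalent to `x ∈ V₀ⁿ`.) -/
def plate {n : ℕ} (L : List (Finset (Fin n))) : Set (Fin n → ℝ) :=
  {x | (∑ i, x i = 0) ∧ (∀ j, j ∉ lUnion L → x j = 0) ∧ (∑ j ∈ lUnion L, x j = 0) ∧
    ∀ i : ℕ, 0 < i → i < L.length → 0 ≤ ∑ j ∈ lUnion (L.take i), x j}

/-- `ℚ`-valued indicator function of a set of points of `ℝⁿ`. -/
noncomputable def ind {n : ℕ} (S : Set (Fin n → ℝ)) : (Fin n → ℝ) → ℚ :=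
  fun x => if x ∈ S then 1 else 0

/-- The index of the block of `L` containing the element `a`. -/
def blockIdx {n : ℕ} (L : List (Finset (Fin n))) (a : Fin n) : ℕ :=
  L.findIdx fun B => decide (a ∈ B)

/-- The index of the block of `L` containing the set `B`. -/
def subIdx {n : ℕ} (L : List (Finset (Fin n))) (B : Finset (Fin n)) : ℕ :=
  L.findIdx fun C => decide (B ⊆ C)

/-- `B` is contained in one of the blocks of `L`. -/
def memBlock {n : ℕ} (L : List (Finset (Fin n))) (B : Finset (Fin n)) : Prop :=
  ∃ j < L.length, B ⊆ L.getD j ∅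

/-- The list `(S_l, S_{l−1}, …, S₁, S_{l+1}, …, S_k)`. -/
def arrList (n k l : ℕ) (S : ℕ → Finset (Fin n)) : List (Finset (Fin n)) :=
  ((List.range l).map fun i => S (l - i)) ++ ((List.range (k - l)).map fun i => S (l + 1 + i))

/-- The coordinate-sum linear functional on `ℝⁿ`. -/
def sumLin (n : ℕ) : (Fin n → ℝ) →ₗ[ℝ] ℝ where
  toFun x := ∑ i, x i
  map_add' x y := by simp [Finset.sum_add_distrib]
  map_smul' c x := by simp [Finset.mul_sum]

/-- The hyperplane `V₀ⁿ = {x ∈ ℝⁿ : x₁ + ⋯ + xₙ = 0}`, as a submodule of `ℝⁿ`. -/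
def V0 (n : ℕ) : Submodule ℝ (Fin n → ℝ) := LinearMap.ker (sumLin n)

/-- The condition on the ordered set partitions `π` of `{1,…,n}` appearing in the
straightening formula in the quotient `𝒫ⁿ`: each block of `π` is a union of some of the
`S_i`; the block containing `S_{i+1}` is weakly later than the block containing `S_i` for
`i = 1,…,l−1`; the block containing `S₁` strictly precedes the block containing `S_{l+1}`;
and the block containing `S_i` strictly precedes the block containing `S_{i+1}` for
`i = l+1,…,k−1`. -/
def QuotCond (n k l : ℕ) (S : ℕ → Finset (Fin n)) (π : List (Finset (Fin n))) : Prop :=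
  IsOSP Finset.univ π ∧
  (∀ i : ℕ, 1 ≤ i → i ≤ k → memBlock π (S i)) ∧
  (∀ i : ℕ, 1 ≤ i → i < l → subIdx π (S i) ≤ subIdx π (S (i + 1))) ∧
  (l < k → subIdx π (S 1) < subIdx π (S (l + 1))) ∧
  (∀ i : ℕ, l + 1 ≤ i → i < k → subIdx π (S i) < subIdx π (S (i + 1)))



theorem mem_lUnion {n : ℕ} (L : List (Finset (Fin n))) (t : Fin n) :
    t ∈ lUnion L ↔ ∃ B ∈ L, t ∈ B := by
  induction L with
  | nil => simp [lUnion]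
  | cons C L ih =>
    have : lUnion (C :: L) = C ∪ lUnion L := rfl
    rw [this, Finset.mem_union, ih]; simp

theorem lUnion_snoc {n : ℕ} (L : List (Finset (Fin n))) (B : Finset (Fin n)) :
    lUnion (L ++ [B]) = lUnion L ∪ B := by
  ext t
  simp only [mem_lUnion, Finset.mem_union, List.mem_append, List.mem_singleton]
  constructor
  · rintro ⟨C, hC | rfl, ht⟩
    · exact Or.inl ⟨C, hC, ht⟩
    · exact Or.inr ht
  · rintro (⟨C, hC, ht⟩ | ht)
    · exact ⟨C, Or.inl hC, ht⟩
    · exact ⟨B, Or.inr rfl, ht⟩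

/-- union of `S 1..S a` and `S (l+1) .. S (l+b)`. -/
noncomputable def U {n : ℕ} (l : ℕ) (S : ℕ → Finset (Fin n)) (a b : ℕ) : Finset (Fin n) :=
  (Finset.Icc 1 a).biUnion S ∪ (Finset.Icc 1 b).biUnion (fun i => S (l + i))

theorem mem_U {n : ℕ} (l : ℕ) (S : ℕ → Finset (Fin n)) (a b : ℕ) (t : Fin n) :
    t ∈ U l S a b ↔ (∃ i, (1 ≤ i ∧ i ≤ a) ∧ t ∈ S i) ∨ (∃ i, (1 ≤ i ∧ i ≤ b) ∧ t ∈ S (l + i)) := by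
  simp [U]

def Step (a b a' b' : ℕ) : Prop :=
  (b = b' ∧ a < a' ∧ (b = 0 ∨ 1 ≤ a)) ∨ (b + 1 = b' ∧ 1 ≤ a ∧ a ≤ a')

inductive Ch {n : ℕ} (l : ℕ) (S : ℕ → Finset (Fin n)) : ℕ → ℕ → List (Finset (Fin n)) → Prop
  | nil : Ch l S 0 0 []
  | snoc {a b a' b' : ℕ} {L : List (Finset (Fin n))} (h : Ch l S a b L) (hs : Step a b a' b') :
      Ch l S a' b' (L ++ [U l S a' b' \ U l S a b])

structure Good {n : ℕ} (l r : ℕ) (S : ℕ → Finset (Fin n)) : Prop where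
  ne : ∀ i, 1 ≤ i → i ≤ l + r → (S i).Nonempty
  dj : ∀ i j, 1 ≤ i → i ≤ l + r → 1 ≤ j → j ≤ l + r → i ≠ j → Disjoint (S i) (S j)

theorem U_mono {n : ℕ} {l : ℕ} {S : ℕ → Finset (Fin n)} {a b a' b' : ℕ} (ha : a ≤ a')
    (hb : b ≤ b') : U l S a b ⊆ U l S a' b' := by
  intro t
  rw [mem_U, mem_U]
  rintro (⟨i, hi, ht⟩ | ⟨i, hi, ht⟩)
  · exact Or.inl ⟨i, ⟨hi.1, hi.2.trans ha⟩, ht⟩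
  · exact Or.inr ⟨i, ⟨hi.1, hi.2.trans hb⟩, ht⟩

theorem Step.le {a b a' b' : ℕ} (h : Step a b a' b') : a ≤ a' ∧ b ≤ b' ∧ a + b < a' + b' := by
  unfold Step at h; omega

theorem Ch.lUnion {n : ℕ} {l : ℕ} {S : ℕ → Finset (Fin n)} {a b : ℕ}
    {L : List (Finset (Fin n))} (h : Ch l S a b L) : lUnion L = U l S a b := by
  induction h with
  | nil => simp [PlatesPaper.lUnion, U]
  | snoc h hs ih =>
    rw [lUnion_snoc, ih]
    exact Finset.union_sdiff_of_subset (U_mono hs.le.1 hs.le.2.1)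

theorem Ch.length {n : ℕ} {l : ℕ} {S : ℕ → Finset (Fin n)} {a b : ℕ}
    {L : List (Finset (Fin n))} (h : Ch l S a b L) : L.length ≤ a + b := by
  induction h with
  | nil => simp
  | snoc h hs ih =>
    have := hs.le
    simp; omega

theorem Ch.finite {n : ℕ} (l : ℕ) (S : ℕ → Finset (Fin n)) (a b : ℕ) :
    {L | Ch l S a b L}.Finite :=
  (List.finite_length_le (Finset (Fin n)) (a + b)).subset fun _ h => Ch.length h

theorem Good.mem1 {n l r : ℕ} {S : ℕ → Finset (Fin n)} (hG : Good l r S) {a b i : ℕ} {t : Fin n}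
    (ha : a ≤ l) (hb : b ≤ r) (hi : 1 ≤ i) (hil : i ≤ l) (ht : t ∈ S i) :
    t ∈ U l S a b ↔ i ≤ a := by
  rw [mem_U]
  constructor
  · rintro (⟨j, hj, htj⟩ | ⟨j, hj, htj⟩)
    · by_contra hc
      exact Finset.disjoint_left.1 (hG.dj i j hi (by omega) hj.1 (by omega) (by omega)) ht htj
    · exact absurd htj (Finset.disjoint_left.1
        (hG.dj i (l + j) hi (by omega) (by omega) (by omega) (by omega)) ht)
  · intro h
    exact Or.inl ⟨i, ⟨hi, h⟩, ht⟩

theorem Good.mem2 {n l r : ℕ} {S : ℕ → Finset (Fin n)} (hG : Good l r S) {a b i : ℕ} {t : Fin n}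
    (ha : a ≤ l) (hb : b ≤ r) (hi : 1 ≤ i) (hil : i ≤ r) (ht : t ∈ S (l + i)) :
    t ∈ U l S a b ↔ i ≤ b := by
  rw [mem_U]
  constructor
  · rintro (⟨j, hj, htj⟩ | ⟨j, hj, htj⟩)
    · exact absurd htj (Finset.disjoint_left.1
        (hG.dj (l + i) j (by omega) (by omega) (by omega) (by omega) (by omega)) ht)
    · by_contra hc
      exact Finset.disjoint_left.1 (hG.dj (l + i) (l + j) (by omega) (by omega) (by omega)
        (by omega) (by omega)) ht htj
  · intro h
    exact Or.inr ⟨i, ⟨hi, h⟩, ht⟩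

theorem Good.U_sub {n l r : ℕ} {S : ℕ → Finset (Fin n)} (hG : Good l r S) {a b a' b' : ℕ}
    (ha : a ≤ l) (hb : b ≤ r) (ha' : a' ≤ l) (hb' : b' ≤ r) (h : U l S a b ⊆ U l S a' b') :
    a ≤ a' ∧ b ≤ b' := by
  constructor
  · rcases Nat.eq_zero_or_pos a with h0 | h0
    · omega
    · obtain ⟨t, ht⟩ := hG.ne a h0 (by omega)
      exact (hG.mem1 ha' hb' h0 ha ht).1 (h ((hG.mem1 ha hb h0 ha ht).2 le_rfl))
  · rcases Nat.eq_zero_or_pos b with h0 | h0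
    · omega
    · obtain ⟨t, ht⟩ := hG.ne (l + b) (by omega) (by omega)
      exact (hG.mem2 ha' hb' h0 hb ht).1 (h ((hG.mem2 ha hb h0 hb ht).2 le_rfl))

theorem Good.U_inj {n l r : ℕ} {S : ℕ → Finset (Fin n)} (hG : Good l r S) {a b a' b' : ℕ}
    (ha : a ≤ l) (hb : b ≤ r) (ha' : a' ≤ l) (hb' : b' ≤ r) (h : U l S a b = U l S a' b') :
    a = a' ∧ b = b' := by
  have h1 := hG.U_sub ha hb ha' hb' h.subset
  have h2 := hG.U_sub ha' hb' ha hb h.symm.subset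
  omega

/-- signed weight -/
noncomputable def wt {n : ℕ} (x : Fin n → ℝ) (L : List (Finset (Fin n))) : ℚ :=
  if ∀ i : ℕ, 0 < i → i ≤ L.length → 0 ≤ ∑ j ∈ lUnion (L.take i), x j then (-1) ^ L.length else 0

theorem wt_snoc {n : ℕ} (x : Fin n → ℝ) (L : List (Finset (Fin n))) (B : Finset (Fin n)) :
    wt x (L ++ [B]) = if 0 ≤ ∑ j ∈ lUnion (L ++ [B]), x j then - wt x L else 0 := by
  have key : (∀ i : ℕ, 0 < i → i ≤ (L ++ [B]).length →
      0 ≤ ∑ j ∈ lUnion ((L ++ [B]).take i), x j) ↔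
      (0 ≤ ∑ j ∈ lUnion (L ++ [B]), x j) ∧
      (∀ i : ℕ, 0 < i → i ≤ L.length → 0 ≤ ∑ j ∈ lUnion (L.take i), x j) := by
    constructor
    · intro h
      refine ⟨?_, fun i hi hiL => ?_⟩
      · have := h (L.length + 1) (by omega) (by simp)
        rwa [List.take_of_length_le (by simp)] at this
      · have := h i hi (by simp; omega)
        rwa [List.take_append_of_le_length hiL] at this
    · rintro ⟨h1, h2⟩ i hi hiL
      rcases Nat.lt_or_ge L.length i with h | h
      · rwa [List.take_of_length_le (by simp; omega)]
      · rw [List.take_append_of_le_length h]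
        exact h2 i hi h
  unfold wt
  rw [if_congr key rfl rfl]
  by_cases h1 : 0 ≤ ∑ j ∈ lUnion (L ++ [B]), x j
  · by_cases h2 : ∀ i : ℕ, 0 < i → i ≤ L.length → 0 ≤ ∑ j ∈ lUnion (L.take i), x j
    · rw [if_pos ⟨h1, h2⟩, if_pos h1, if_pos h2]
      simp [pow_succ]
    · rw [if_neg (fun h => h2 h.2), if_pos h1, if_neg h2]; simp
  · rw [if_neg (fun h => h1 h.1), if_neg h1]

noncomputable def A {n : ℕ} (l : ℕ) (S : ℕ → Finset (Fin n)) (a b : ℕ) :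
    Finset (List (Finset (Fin n))) := (Ch.finite l S a b).toFinset

theorem mem_A {n : ℕ} {l : ℕ} {S : ℕ → Finset (Fin n)} {a b : ℕ} {L : List (Finset (Fin n))} :
    L ∈ A l S a b ↔ Ch l S a b L := by simp [A]

noncomputable def D {n : ℕ} (l : ℕ) (S : ℕ → Finset (Fin n)) (x : Fin n → ℝ) (a b : ℕ) : ℚ :=
  ∑ L ∈ A l S a b, wt x L

theorem D_zero {n : ℕ} (l : ℕ) (S : ℕ → Finset (Fin n)) (x : Fin n → ℝ) : D l S x 0 0 = 1 := by
  have : A l S 0 0 = {[]} := by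
    ext L
    rw [mem_A, Finset.mem_singleton]
    constructor
    · intro h
      exact List.length_eq_zero_iff.1 (Nat.le_zero.1 h.length)
    · rintro rfl; exact Ch.nil
  rw [D, this, Finset.sum_singleton]
  simp [wt]

theorem D_rec {n l r : ℕ} {S : ℕ → Finset (Fin n)} (hG : Good l r S) (x : Fin n → ℝ) {a b : ℕ}
    (ha : a ≤ l) (hb : b ≤ r) (ha1 : 1 ≤ a) :
    D l S x a b = if 0 ≤ ∑ j ∈ U l S a b, x j then
      - ∑ p ∈ (Finset.range (a + 1) ×ˢ Finset.range (b + 1)).filter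
          (fun p => Step p.1 p.2 a b), D l S x p.1 p.2 else 0 := by
  have hA : A l S a b = ((Finset.range (a + 1) ×ˢ Finset.range (b + 1)).filter
      (fun p => Step p.1 p.2 a b)).biUnion
      (fun p => (A l S p.1 p.2).image (fun L => L ++ [U l S a b \ U l S p.1 p.2])) := by
    ext L
    simp only [mem_A, Finset.mem_biUnion, Finset.mem_filter, Finset.mem_product,
      Finset.mem_range, Finset.mem_image]
    constructor
    · intro h
      cases h with
      | nil => omega
      | snoc h hs =>
        rename_i a0 b0 L0
        have := hs.le
        exact ⟨(a0, b0), ⟨⟨by simp; omega, by simp; omega⟩, hs⟩, L0, h, rfl⟩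
    · rintro ⟨p, ⟨-, hs⟩, L0, h, rfl⟩
      exact Ch.snoc h hs
  rw [D, hA, Finset.sum_biUnion]
  · split_ifs with hp
    · rw [← Finset.sum_neg_distrib]
      refine Finset.sum_congr rfl fun p hpm => ?_
      rw [Finset.sum_image, D, ← Finset.sum_neg_distrib]
      · refine Finset.sum_congr rfl fun L hL => ?_
        rw [wt_snoc, (Ch.snoc (mem_A.1 hL) (Finset.mem_filter.1 hpm).2).lUnion, if_pos hp]
      · intro L _ L' _ h
        exact List.append_cancel_right h
    · refine Finset.sum_eq_zero fun p hpm => Finset.sum_eq_zero fun L hL => ?_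
      obtain ⟨L0, hL0, rfl⟩ := Finset.mem_image.1 hL
      rw [wt_snoc, (Ch.snoc (mem_A.1 hL0) (Finset.mem_filter.1 hpm).2).lUnion, if_neg hp]
  · intro p hpm q hqm hne
    rw [Function.onFun, Finset.disjoint_left]
    intro L hL hL'
    obtain ⟨L0, hL0, rfl⟩ := Finset.mem_image.1 hL
    obtain ⟨L1, hL1, h⟩ := Finset.mem_image.1 hL'
    have h01 : L1 = L0 := (List.append_inj' h rfl).1
    subst h01
    have e := (mem_A.1 hL0).lUnion.symm.trans (mem_A.1 hL1).lUnion
    have s1 := (Finset.mem_filter.1 (Finset.mem_coe.1 hpm)).2.le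
    have s2 := (Finset.mem_filter.1 (Finset.mem_coe.1 hqm)).2.le
    have := hG.U_inj (by omega) (by omega) (by omega) (by omega) e
    exact hne (Prod.ext this.1 this.2)

theorem D_row0 {n l r : ℕ} {S : ℕ → Finset (Fin n)} (hG : Good l r S) (x : Fin n → ℝ) {a : ℕ}
    (ha : a + 1 ≤ l) :
    D l S x (a + 1) 0 = if 0 ≤ ∑ j ∈ U l S (a + 1) 0, x j then
      - (1 + ∑ i ∈ Finset.Icc 1 a, D l S x i 0) else 0 := by
  rw [D_rec hG x ha (Nat.zero_le _) (by omega)]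
  congr 2
  have : (Finset.range (a + 1 + 1) ×ˢ Finset.range (0 + 1)).filter
      (fun p => Step p.1 p.2 (a + 1) 0) = (Finset.range (a + 1)).image (fun i => (i, 0)) := by
    ext ⟨i, j⟩
    simp [Step]
    omega
  rw [this, Finset.sum_image (by intro i _ j _ h; simpa using h)]
  have h2 : Finset.range (a + 1) = insert 0 (Finset.Icc 1 a) := by
    ext i; simp; omega
  rw [h2, Finset.sum_insert (by simp), D_zero]

theorem D_row {n l r : ℕ} {S : ℕ → Finset (Fin n)} (hG : Good l r S) (x : Fin n → ℝ) {a b : ℕ}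
    (ha : a + 1 ≤ l) (hb : b + 1 ≤ r) :
    D l S x (a + 1) (b + 1) = if 0 ≤ ∑ j ∈ U l S (a + 1) (b + 1), x j then
      - (∑ i ∈ Finset.Icc 1 a, D l S x i (b + 1) +
         ∑ i ∈ Finset.Icc 1 (a + 1), D l S x i b) else 0 := by
  rw [D_rec hG x ha hb (by omega)]
  congr 2
  have : (Finset.range (a + 1 + 1) ×ˢ Finset.range (b + 1 + 1)).filter
      (fun p => Step p.1 p.2 (a + 1) (b + 1)) = (Finset.Icc 1 a).image (fun i => (i, b + 1)) ∪
        (Finset.Icc 1 (a + 1)).image (fun i => (i, b)) := by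
    ext ⟨i, j⟩
    simp [Step]
    omega
  rw [this, Finset.sum_union, Finset.sum_image (by intro i _ j _ h; simpa using h),
    Finset.sum_image (by intro i _ j _ h; simpa using h)]
  rw [Finset.disjoint_left]
  rintro ⟨i, j⟩
  simp
  omega

theorem E_formula (l r : ℕ) (D : ℕ → ℕ → ℚ) (Y V : ℕ → ℝ)
    (h0 : ∀ a, a + 1 ≤ l → D (a + 1) 0 = if 0 ≤ Y (a + 1) + V 0 then
      - (1 + ∑ i ∈ Finset.Icc 1 a, D i 0) else 0)
    (h1 : ∀ a b, a + 1 ≤ l → b + 1 ≤ r → D (a + 1) (b + 1) = if 0 ≤ Y (a + 1) + V (b + 1) then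
      - (∑ i ∈ Finset.Icc 1 a, D i (b + 1) + ∑ i ∈ Finset.Icc 1 (a + 1), D i b) else 0)
    (b : ℕ) (hb : b ≤ r) (a : ℕ) (ha : a ≤ l) :
    ∑ i ∈ Finset.Icc 1 a, D i b = (-1) ^ (b + 1) *
      if ∃ c, 1 ≤ c ∧ c ≤ a ∧ ∀ i ≤ b, 0 ≤ Y c + V i then 1 else 0 := by
  induction b generalizing a with
  | zero =>
    induction a with
    | zero =>
      rw [if_neg (by rintro ⟨c, h⟩; omega)]; simp
    | succ a ih =>
      rw [Finset.sum_Icc_succ_top (by omega), h0 a ha, ih (by omega)]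
      by_cases hp : 0 ≤ Y (a + 1) + V 0
      · rw [if_pos hp]
        rw [if_pos (⟨a + 1, by omega, le_rfl, fun i hi => by
          obtain rfl : i = 0 := by omega
          exact hp⟩ : ∃ c, 1 ≤ c ∧ c ≤ a + 1 ∧ ∀ i ≤ 0, 0 ≤ Y c + V i)]
        ring
      · rw [if_neg hp, add_zero]
        congr 1
        refine if_congr ?_ rfl rfl
        constructor
        · rintro ⟨c, h1, h2, h3⟩; exact ⟨c, h1, by omega, h3⟩
        · rintro ⟨c, h1, h2, h3⟩
          refine ⟨c, h1, ?_, h3⟩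
          by_contra hc
          obtain rfl : c = a + 1 := by omega
          exact hp (h3 0 le_rfl)
  | succ b ihb =>
    induction a with
    | zero =>
      rw [if_neg (by rintro ⟨c, h⟩; omega)]; simp
    | succ a ih =>
      rw [Finset.sum_Icc_succ_top (by omega), h1 a b ha hb]
      by_cases hp : 0 ≤ Y (a + 1) + V (b + 1)
      · rw [if_pos hp, ihb (by omega) (a + 1) ha]
        have : (∃ c, 1 ≤ c ∧ c ≤ a + 1 ∧ ∀ i ≤ b, 0 ≤ Y c + V i) ↔
            (∃ c, 1 ≤ c ∧ c ≤ a + 1 ∧ ∀ i ≤ b + 1, 0 ≤ Y c + V i) := by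
          constructor
          · rintro ⟨c, h1, h2, h3⟩
            rcases le_total (Y (a + 1)) (Y c) with h | h
            · refine ⟨c, h1, h2, fun i hi => ?_⟩
              rcases Nat.lt_or_ge i (b + 1) with h4 | h4
              · exact h3 i (by omega)
              · obtain rfl : i = b + 1 := by omega
                linarith
            · refine ⟨a + 1, by omega, le_rfl, fun i hi => ?_⟩
              rcases Nat.lt_or_ge i (b + 1) with h4 | h4
              · have := h3 i (by omega)
                linarith
              · obtain rfl : i = b + 1 := by omega
                exact hp
          · rintro ⟨c, h1, h2, h3⟩
            exact ⟨c, h1, h2, fun i hi => h3 i (by omega)⟩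
        rw [if_congr this rfl rfl]
        ring
      · rw [if_neg hp, add_zero, ih (by omega)]
        congr 1
        refine if_congr ?_ rfl rfl
        constructor
        · rintro ⟨c, h1, h2, h3⟩; exact ⟨c, h1, by omega, h3⟩
        · rintro ⟨c, h1, h2, h3⟩
          refine ⟨c, h1, ?_, h3⟩
          by_contra hc
          obtain rfl : c = a + 1 := by omega
          exact hp (h3 (b + 1) le_rfl)

theorem D_final (l r : ℕ) (hl : 1 ≤ l) (D : ℕ → ℕ → ℚ) (Y V : ℕ → ℝ)
    (h0 : ∀ a, a + 1 ≤ l → D (a + 1) 0 = if 0 ≤ Y (a + 1) + V 0 then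
      - (1 + ∑ i ∈ Finset.Icc 1 a, D i 0) else 0)
    (h1 : ∀ a b, a + 1 ≤ l → b + 1 ≤ r → D (a + 1) (b + 1) = if 0 ≤ Y (a + 1) + V (b + 1) then
      - (∑ i ∈ Finset.Icc 1 a, D i (b + 1) + ∑ i ∈ Finset.Icc 1 (a + 1), D i b) else 0)
    (htot : Y l + V r = 0) (hgen : ∀ a, 1 ≤ a → a < l → Y a + V r ≠ 0) :
    D l r = (-1) ^ (r + 1) * if (∀ a, 1 ≤ a → a < l → 0 ≤ Y l - Y a) ∧
      (∀ b ≤ r, 0 ≤ Y l + V b) then 1 else 0 := by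
  have e1 := E_formula l r D Y V h0 h1 r le_rfl l le_rfl
  have e2 := E_formula l r D Y V h0 h1 r le_rfl (l - 1) (by omega)
  obtain ⟨m, rfl⟩ : ∃ m, l = m + 1 := ⟨l - 1, by omega⟩
  rw [Finset.sum_Icc_succ_top (by omega)] at e1
  rw [Nat.add_sub_cancel] at e2
  rw [e2] at e1
  have e3 := eq_sub_of_add_eq' e1
  rw [e3, ← mul_sub]
  congr 1
  by_cases hA : ∀ a, 1 ≤ a → a < m + 1 → 0 ≤ Y (m + 1) - Y a
  · by_cases hB : ∀ b ≤ r, 0 ≤ Y (m + 1) + V b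
    · have hP : ((∀ a, 1 ≤ a → a < m + 1 → 0 ≤ Y (m + 1) - Y a) ∧
      (∀ b ≤ r, 0 ≤ Y (m + 1) + V b)) := ⟨hA, hB⟩
      rw [if_pos hP, if_pos ⟨m + 1, by omega, le_rfl, hB⟩, if_neg, sub_zero]
      rintro ⟨c, hc1, hc2, hc3⟩
      have a1 := hc3 r le_rfl
      have a2 := hA c hc1 (by omega)
      exact hgen c hc1 (by omega) (by linarith)
    · have hP : ¬ ((∀ a, 1 ≤ a → a < m + 1 → 0 ≤ Y (m + 1) - Y a) ∧
      (∀ b ≤ r, 0 ≤ Y (m + 1) + V b)) := fun h => hB h.2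
      rw [if_neg hP]
      rw [if_neg, if_neg, sub_zero]
      · rintro ⟨c, hc1, hc2, hc3⟩
        refine hB fun b hb => ?_
        have a1 := hc3 b hb
        have a2 := hA c hc1 (by omega)
        linarith
      · rintro ⟨c, hc1, hc2, hc3⟩
        refine hB fun b hb => ?_
        have a1 := hc3 b hb
        rcases Nat.lt_or_ge c (m + 1) with h | h
        · have a2 := hA c hc1 h
          linarith
        · obtain rfl : c = m + 1 := by omega
          exact a1
  · have hP : ¬ ((∀ a, 1 ≤ a → a < m + 1 → 0 ≤ Y (m + 1) - Y a) ∧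
      (∀ b ≤ r, 0 ≤ Y (m + 1) + V b)) := fun h => hA h.1
    rw [if_neg hP]
    push Not at hA
    obtain ⟨a, ha1, ha2, ha3⟩ := hA
    rw [sub_eq_zero]
    refine if_congr ?_ rfl rfl
    constructor
    · rintro ⟨c, hc1, hc2, hc3⟩
      rcases Nat.lt_or_ge c (m + 1) with h | h
      · exact ⟨c, hc1, by omega, hc3⟩
      · obtain rfl : c = m + 1 := by omega
        refine ⟨a, ha1, by omega, fun i hi => ?_⟩
        have := hc3 i hi
        linarith
    · rintro ⟨c, hc1, hc2, hc3⟩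
      exact ⟨c, hc1, by omega, hc3⟩


theorem subIdx_lt {n : ℕ} (L : List (Finset (Fin n))) (T : Finset (Fin n)) :
    subIdx L T < L.length ↔ ∃ C ∈ L, T ⊆ C := by
  unfold subIdx
  rw [List.findIdx_lt_length]
  simp

theorem subIdx_spec {n : ℕ} (L : List (Finset (Fin n))) (T : Finset (Fin n))
    (h : subIdx L T < L.length) : T ⊆ L[subIdx L T] := by
  have := List.findIdx_getElem (p := fun C => decide (T ⊆ C)) (w := h)
  simp only [decide_eq_true_eq] at this
  exact this

theorem memBlock_iff {n : ℕ} (L : List (Finset (Fin n))) (T : Finset (Fin n)) :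
    memBlock L T ↔ subIdx L T < L.length := by
  rw [subIdx_lt]
  unfold memBlock
  constructor
  · rintro ⟨j, hj, h⟩
    rw [List.getD_eq_getElem _ _ hj] at h
    exact ⟨_, List.getElem_mem hj, h⟩
  · rintro ⟨C, hC, h⟩
    obtain ⟨j, hj, rfl⟩ := List.getElem_of_mem hC
    refine ⟨j, hj, ?_⟩
    rwa [List.getD_eq_getElem _ _ hj]

theorem subIdx_old {n : ℕ} (L : List (Finset (Fin n))) (B T : Finset (Fin n))
    (h : subIdx L T < L.length) : subIdx (L ++ [B]) T = subIdx L T := by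
  unfold subIdx at *
  rw [List.findIdx_append, if_pos h]

theorem subIdx_new {n : ℕ} (L : List (Finset (Fin n))) (B T : Finset (Fin n))
    (h : ¬ subIdx L T < L.length) (hB : T ⊆ B) : subIdx (L ++ [B]) T = L.length := by
  unfold subIdx at *
  rw [List.findIdx_append, if_neg h]
  simp [List.findIdx_cons, hB]

structure Inv {n : ℕ} (l : ℕ) (S : ℕ → Finset (Fin n)) (a b : ℕ)
    (L : List (Finset (Fin n))) : Prop where
  osp : IsOSP (U l S a b) L
  m1 : ∀ i, 1 ≤ i → i ≤ a → subIdx L (S i) < L.length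
  m2 : ∀ i, 1 ≤ i → i ≤ b → subIdx L (S (l + i)) < L.length
  c1 : ∀ i, 1 ≤ i → i + 1 ≤ a → subIdx L (S i) ≤ subIdx L (S (i + 1))
  c2 : 1 ≤ b → 1 ≤ a ∧ subIdx L (S 1) < subIdx L (S (l + 1))
  c3 : ∀ i, 1 ≤ i → i + 1 ≤ b → subIdx L (S (l + i)) < subIdx L (S (l + (i + 1)))

theorem Good.inv {n l r : ℕ} {S : ℕ → Finset (Fin n)} (hG : Good l r S) {a b : ℕ}
    {L : List (Finset (Fin n))} (h : Ch l S a b L) (ha : a ≤ l) (hb : b ≤ r) :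
    Inv l S a b L := by
  induction h with
  | nil =>
    refine ⟨⟨by simp, by simp, by simp [lUnion, U]⟩, ?_, ?_, ?_, ?_, ?_⟩ <;> intros <;> omega
  | @snoc a b a' b' L h hs ih =>
    have hle := hs.le
    have I := ih (by omega) (by omega)
    have hU := h.lUnion
    have h1 : ∀ i, 1 ≤ i → i ≤ a' →
        (i ≤ a ∧ subIdx (L ++ [U l S a' b' \ U l S a b]) (S i) = subIdx L (S i) ∧
          subIdx L (S i) < L.length) ∨
        (a < i ∧ subIdx (L ++ [U l S a' b' \ U l S a b]) (S i) = L.length) := by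
      intro i hi hia
      rcases Nat.lt_or_ge a i with hc | hc
      · right
        refine ⟨hc, subIdx_new _ _ _ ?_ ?_⟩
        · rw [subIdx_lt]
          rintro ⟨C, hC, hsub⟩
          obtain ⟨t, ht⟩ := hG.ne i hi (by omega)
          have : t ∈ lUnion L := (mem_lUnion L t).2 ⟨C, hC, hsub ht⟩
          rw [hU, hG.mem1 (by omega) (by omega) hi (by omega) ht] at this
          omega
        · intro t ht
          rw [Finset.mem_sdiff, hG.mem1 (by omega) (by omega) hi (by omega) ht,
            hG.mem1 (by omega) (by omega) hi (by omega) ht]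
          omega
      · left
        have := I.m1 i hi hc
        exact ⟨hc, subIdx_old _ _ _ this, this⟩
    have h2 : ∀ i, 1 ≤ i → i ≤ b' →
        (i ≤ b ∧ subIdx (L ++ [U l S a' b' \ U l S a b]) (S (l + i)) = subIdx L (S (l + i)) ∧
          subIdx L (S (l + i)) < L.length) ∨
        (b < i ∧ subIdx (L ++ [U l S a' b' \ U l S a b]) (S (l + i)) = L.length) := by
      intro i hi hia
      rcases Nat.lt_or_ge b i with hc | hc
      · right
        refine ⟨hc, subIdx_new _ _ _ ?_ ?_⟩
        · rw [subIdx_lt]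
          rintro ⟨C, hC, hsub⟩
          obtain ⟨t, ht⟩ := hG.ne (l + i) (by omega) (by omega)
          have : t ∈ lUnion L := (mem_lUnion L t).2 ⟨C, hC, hsub ht⟩
          rw [hU, hG.mem2 (by omega) (by omega) hi (by omega) ht] at this
          omega
        · intro t ht
          rw [Finset.mem_sdiff, hG.mem2 (by omega) (by omega) hi (by omega) ht,
            hG.mem2 (by omega) (by omega) hi (by omega) ht]
          omega
      · left
        have := I.m2 i hi hc
        exact ⟨hc, subIdx_old _ _ _ this, this⟩
    have hlen : (L ++ [U l S a' b' \ U l S a b]).length = L.length + 1 := by simp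
    refine ⟨⟨?_, ?_, (Ch.snoc h hs).lUnion⟩, ?_, ?_, ?_, ?_, ?_⟩
    · intro B hB
      rw [List.mem_append, List.mem_singleton] at hB
      rcases hB with hB | rfl
      · exact I.osp.1 B hB
      · rw [Finset.sdiff_nonempty]
        intro hsub
        have := hG.U_sub ha hb (by omega) (by omega) hsub
        omega
    · rw [List.pairwise_append]
      refine ⟨I.osp.2.1, by simp, ?_⟩
      intro B hB C hC
      rw [List.mem_singleton] at hC
      subst hC
      rw [Finset.disjoint_left]
      intro t ht ht'
      rw [Finset.mem_sdiff, ← hU] at ht'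
      exact ht'.2 ((mem_lUnion L t).2 ⟨B, hB, ht⟩)
    · intro i hi hia
      rw [hlen]
      have := h1 i hi hia
      omega
    · intro i hi hib
      rw [hlen]
      have := h2 i hi hib
      omega
    · intro i hi hia
      have e1 := h1 i hi (by omega)
      have e2 := h1 (i + 1) (by omega) hia
      have e3 := I.c1 i hi
      omega
    · intro hb1
      have ha1 : 1 ≤ a := by
        have := I.c2
        unfold Step at hs
        omega
      have e1 := h1 1 le_rfl (by omega)
      have e2 := h2 1 le_rfl hb1
      have e3 := I.c2
      omega
    · intro i hi hib
      have e1 := h2 i hi (by omega)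
      have e2 := h2 (i + 1) (by omega) hib
      have e3 := I.c3 i hi
      unfold Step at hs
      omega

theorem cutoff (P : ℕ → Prop) (l : ℕ) (h : ∀ i, 1 ≤ i → i + 1 ≤ l → P (i + 1) → P i) :
    ∃ a ≤ l, ∀ i, 1 ≤ i → i ≤ l → (P i ↔ i ≤ a) := by
  induction l with
  | zero => exact ⟨0, le_rfl, fun i h1 h2 => by omega⟩
  | succ l ih =>
    obtain ⟨a, ha, hP⟩ := ih (fun i h1 h2 => h i h1 (by omega))
    by_cases hl : P (l + 1)
    · refine ⟨l + 1, le_rfl, fun i h1 h2 => ⟨fun _ => h2, fun _ => ?_⟩⟩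
      rcases Nat.lt_or_ge l i with h3 | h3
      · obtain rfl : i = l + 1 := by omega
        exact hl
      · have hPl : P l := h l (by omega) le_rfl hl
        have := (hP l (by omega) le_rfl).1 hPl
        exact (hP i h1 h3).2 (by omega)
    · refine ⟨a, by omega, fun i h1 h2 => ?_⟩
      rcases Nat.lt_or_ge l i with h3 | h3
      · obtain rfl : i = l + 1 := by omega
        exact ⟨fun h => absurd h hl, fun h => by omega⟩
      · exact hP i h1 h3

theorem mem_take_iff {n : ℕ} {L : List (Finset (Fin n))} (hp : L.Pairwise Disjoint)
    {T : Finset (Fin n)} (hT : subIdx L T < L.length) {t : Fin n} (ht : t ∈ T) (j : ℕ) :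
    t ∈ lUnion (L.take j) ↔ subIdx L T < j := by
  have hs := subIdx_spec L T hT ht
  rw [mem_lUnion]
  constructor
  · rintro ⟨B, hB, htB⟩
    obtain ⟨m, hm, rfl⟩ := List.mem_take_iff_getElem.1 hB
    by_contra hc
    have hlt : m < subIdx L T := by omega
    have := List.pairwise_iff_getElem.1 hp m (subIdx L T) (by omega) hT hlt
    exact Finset.disjoint_left.1 this htB hs
  · intro h
    exact ⟨_, List.mem_take_iff_getElem.2 ⟨subIdx L T, by omega, rfl⟩, hs⟩

theorem Good.lUnion_take {n l r : ℕ} {S : ℕ → Finset (Fin n)} (hG : Good l r S)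
    (huniv : U l S l r = Finset.univ) {L : List (Finset (Fin n))} (hp : L.Pairwise Disjoint)
    (hm : ∀ i, 1 ≤ i → i ≤ l + r → subIdx L (S i) < L.length) {a b j : ℕ} (ha : a ≤ l)
    (hb : b ≤ r) (h1 : ∀ i, 1 ≤ i → i ≤ l → (subIdx L (S i) < j ↔ i ≤ a))
    (h2 : ∀ i, 1 ≤ i → i ≤ r → (subIdx L (S (l + i)) < j ↔ i ≤ b)) :
    lUnion (L.take j) = U l S a b := by
  ext t
  have ht : t ∈ U l S l r := by rw [huniv]; simp
  rw [mem_U] at ht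
  rcases ht with ⟨i, hi, ht⟩ | ⟨i, hi, ht⟩
  · rw [hG.mem1 ha hb hi.1 hi.2 ht, mem_take_iff hp (hm i hi.1 (by omega)) ht, h1 i hi.1 hi.2]
  · rw [hG.mem2 ha hb hi.1 hi.2 ht, mem_take_iff hp (hm (l + i) (by omega) (by omega)) ht,
      h2 i hi.1 hi.2]

theorem quot_iff {n l r : ℕ} {S : ℕ → Finset (Fin n)} (hG : Good l r S) (hl : 1 ≤ l)
    (huniv : U l S l r = Finset.univ) (L : List (Finset (Fin n))) :
    QuotCond n (l + r) l S L ↔ Ch l S l r L := by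
  constructor
  · rintro ⟨⟨hne, hp, hun⟩, hm, q1, q2, q3⟩
    have hm' : ∀ i, 1 ≤ i → i ≤ l + r → subIdx L (S i) < L.length := fun i h1 h2 =>
      (memBlock_iff _ _).1 (hm i h1 h2)
    have cut1 : ∀ j, ∃ a ≤ l, ∀ i, 1 ≤ i → i ≤ l → (subIdx L (S i) < j ↔ i ≤ a) := fun j =>
      cutoff (fun i => subIdx L (S i) < j) l fun i hi hil h => by
        have := q1 i hi (by omega)
        omega
    have cut2 : ∀ j, ∃ b ≤ r, ∀ i, 1 ≤ i → i ≤ r → (subIdx L (S (l + i)) < j ↔ i ≤ b) := fun j =>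
      cutoff (fun i => subIdx L (S (l + i)) < j) r fun i hi hil h => by
        have := q3 (l + i) (by omega) (by omega)
        simp only [← add_assoc] at h ⊢
        omega
    have main : ∀ j ≤ L.length, ∃ a b, a ≤ l ∧ b ≤ r ∧ Ch l S a b (L.take j) ∧
        (∀ i, 1 ≤ i → i ≤ l → (subIdx L (S i) < j ↔ i ≤ a)) ∧
        (∀ i, 1 ≤ i → i ≤ r → (subIdx L (S (l + i)) < j ↔ i ≤ b)) := by
      intro j
      induction j with
      | zero =>
        intro _
        refine ⟨0, 0, by omega, by omega, by simpa using Ch.nil, ?_, ?_⟩ <;> intros <;> omega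
      | succ j ih =>
        intro hj
        obtain ⟨a, b, ha, hb, hch, k1, k2⟩ := ih (by omega)
        obtain ⟨a', ha', k1'⟩ := cut1 (j + 1)
        obtain ⟨b', hb', k2'⟩ := cut2 (j + 1)
        refine ⟨a', b', ha', hb', ?_, k1', k2'⟩
        have e := hG.lUnion_take huniv hp hm' ha hb k1 k2
        have e' := hG.lUnion_take huniv hp hm' ha' hb' k1' k2'
        have htk : L.take (j + 1) = L.take j ++ [L[j]] := by
          rw [List.take_append_getElem]
        rw [htk, lUnion_snoc, e] at e'
        have hdis : Disjoint (U l S a b) L[j] := by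
          rw [← e, Finset.disjoint_left]
          intro t ht ht'
          obtain ⟨B, hB, htB⟩ := (mem_lUnion _ _).1 ht
          obtain ⟨m, hm, rfl⟩ := List.mem_take_iff_getElem.1 hB
          have := List.pairwise_iff_getElem.1 hp m j (by omega) (by omega) (by omega)
          exact Finset.disjoint_left.1 this htB ht'
        have hB : L[j] = U l S a' b' \ U l S a b := by
          rw [← e', Finset.union_sdiff_left, Finset.sdiff_eq_self_of_disjoint hdis.symm]
        rw [htk, hB]
        refine Ch.snoc hch ?_
        have haa : a ≤ a' := by
          rcases Nat.eq_zero_or_pos a with h | h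
          · omega
          · exact (k1' a h ha).1 (by have := (k1 a h ha).2 le_rfl; omega)
        have hbb : b ≤ b' := by
          rcases Nat.eq_zero_or_pos b with h | h
          · omega
          · exact (k2' b h hb).1 (by have := (k2 b h hb).2 le_rfl; omega)
        have hb2 : b' ≤ b + 1 := by
          by_contra hc
          have t1 := (k2' (b + 2) (by omega) (by omega)).2 (by omega)
          have t2 := q3 (l + (b + 1)) (by omega) (by omega)
          have t3 := (k2 (b + 1) (by omega) (by omega)).1 (by
            have : l + (b + 1) + 1 = l + (b + 2) := by omega
            rw [this] at t2
            omega)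
          omega
        have hneq : ¬ (a = a' ∧ b = b') := by
          rintro ⟨rfl, rfl⟩
          have := hne _ (List.getElem_mem (by omega : j < L.length))
          rw [hB] at this
          simp at this
        have ha1 : 1 ≤ b' → 1 ≤ a := by
          intro h
          have t1 := (k2' 1 le_rfl (by omega)).2 h
          have t2 := q2 (by omega)
          exact (k1 1 le_rfl hl).1 (by omega)
        unfold Step
        omega
    obtain ⟨a, b, ha, hb, hch, k1, k2⟩ := main L.length le_rfl
    rw [List.take_length] at hch
    have h1 : a = l := by
      have := (k1 l hl le_rfl).1 (hm' l hl (by omega))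
      omega
    have h2 : b = r := by
      rcases Nat.eq_zero_or_pos r with h | h
      · omega
      · have := (k2 r h le_rfl).1 (hm' (l + r) (by omega) (by omega))
        omega
    rwa [h1, h2] at hch
  · intro h
    have I := hG.inv h le_rfl le_rfl
    refine ⟨huniv ▸ I.osp, ?_, ?_, ?_, ?_⟩
    · intro i hi hik
      rw [memBlock_iff]
      rcases Nat.lt_or_ge l i with h | h
      · have := I.m2 (i - l) (by omega) (by omega)
        rwa [Nat.add_sub_cancel' h.le] at this
      · exact I.m1 i hi h
    · intro i hi hil
      exact I.c1 i hi hil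
    · intro h
      exact (I.c2 (by omega)).2
    · intro i hi hik
      have := I.c3 (i - l) (by omega) (by omega)
      rwa [← add_assoc, Nat.add_sub_cancel' (by omega)] at this

theorem sum_U {n l r : ℕ} {S : ℕ → Finset (Fin n)} (hG : Good l r S) (x : Fin n → ℝ) {a b : ℕ}
    (ha : a ≤ l) (hb : b ≤ r) :
    ∑ j ∈ U l S a b, x j = (∑ i ∈ Finset.Icc 1 a, ∑ j ∈ S i, x j) +
      ∑ i ∈ Finset.Icc 1 b, ∑ j ∈ S (l + i), x j := by
  rw [U, Finset.sum_union, Finset.sum_biUnion, Finset.sum_biUnion]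
  · intro i hi j hj hij
    simp at hi hj
    exact hG.dj _ _ (by omega) (by omega) (by omega) (by omega) (by omega)
  · intro i hi j hj hij
    simp at hi hj
    exact hG.dj _ _ (by omega) (by omega) (by omega) (by omega) (by omega)
  · rw [Finset.disjoint_biUnion_left]
    intro i hi
    rw [Finset.disjoint_biUnion_right]
    intro j hj
    simp at hi hj
    exact hG.dj _ _ (by omega) (by omega) (by omega) (by omega) (by omega)

theorem sum_lUnion {n : ℕ} (x : Fin n → ℝ) (L : List (Finset (Fin n)))
    (hp : L.Pairwise Disjoint) : ∑ j ∈ lUnion L, x j = (L.map fun B => ∑ j ∈ B, x j).sum := by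
  induction L with
  | nil => simp [lUnion]
  | cons C L ih =>
    rw [List.pairwise_cons] at hp
    have : lUnion (C :: L) = C ∪ lUnion L := rfl
    rw [this, Finset.sum_union, ih hp.2]
    · simp
    · rw [Finset.disjoint_left]
      intro t ht ht'
      obtain ⟨B, hB, htB⟩ := (mem_lUnion _ _).1 ht'
      exact Finset.disjoint_left.1 (hp.1 B hB) ht htB

theorem mem_arr {n l r : ℕ} (S : ℕ → Finset (Fin n)) (B : Finset (Fin n)) :
    B ∈ arrList n (l + r) l S ↔ (∃ i, (1 ≤ i ∧ i ≤ l) ∧ B = S i) ∨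
      (∃ i, (1 ≤ i ∧ i ≤ r) ∧ B = S (l + i)) := by
  simp only [arrList, List.mem_append, List.mem_map, List.mem_range]
  constructor
  · rintro (⟨i, hi, rfl⟩ | ⟨i, hi, rfl⟩)
    · exact Or.inl ⟨l - i, by omega, rfl⟩
    · exact Or.inr ⟨1 + i, by omega, by rw [add_assoc]⟩
  · rintro (⟨i, hi, rfl⟩ | ⟨i, hi, rfl⟩)
    · exact Or.inl ⟨l - i, by omega, by congr 1; omega⟩
    · exact Or.inr ⟨i - 1, by omega, by congr 1; omega⟩

theorem arr_good {n l r : ℕ} (S : ℕ → Finset (Fin n))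
    (h : IsOSP Finset.univ (arrList n (l + r) l S)) :
    Good l r S ∧ U l S l r = Finset.univ := by
  obtain ⟨h1, h2, h3⟩ := h
  refine ⟨⟨?_, ?_⟩, ?_⟩
  · intro i hi hik
    apply h1
    rw [mem_arr]
    rcases Nat.lt_or_ge l i with h | h
    · exact Or.inr ⟨i - l, by omega, by congr 1; omega⟩
    · exact Or.inl ⟨i, by omega, rfl⟩
  · have key : ∀ i j, 1 ≤ i → j ≤ l + r → i < j → Disjoint (S i) (S j) := by
      unfold arrList at h2
      rw [List.pairwise_append, List.pairwise_map, List.pairwise_map,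
        List.pairwise_iff_getElem, List.pairwise_iff_getElem] at h2
      obtain ⟨p1, p2, p3⟩ := h2
      intro i j hi hj hij
      rcases Nat.lt_or_ge l i with h | h
      · have := p2 (i - l - 1) (j - l - 1) (by simp; omega) (by simp; omega) (by omega)
        simp only [List.getElem_range] at this
        have e1 : l + 1 + (i - l - 1) = i := by omega
        have e2 : l + 1 + (j - l - 1) = j := by omega
        rwa [e1, e2] at this
      · rcases Nat.lt_or_ge l j with h' | h'
        · refine p3 _ (List.mem_map.2 ⟨l - i, by simp; omega, ?_⟩) _
            (List.mem_map.2 ⟨j - l - 1, by simp; omega, ?_⟩) <;> congr 1 <;> omega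
        · have := p1 (l - j) (l - i) (by simp; omega) (by simp; omega) (by omega)
          simp only [List.getElem_range] at this
          have e1 : l - (l - i) = i := by omega
          have e2 : l - (l - j) = j := by omega
          rw [e1, e2] at this
          exact this.symm
    intro i j hi hik hj hjk hij
    rcases Nat.lt_or_gt_of_ne hij with h | h
    · exact key i j hi hjk h
    · exact (key j i hj hik h).symm
  · rw [← h3]
    ext t
    rw [mem_U, mem_lUnion]
    constructor
    · rintro (⟨i, hi, ht⟩ | ⟨i, hi, ht⟩)
      · exact ⟨S i, (mem_arr S _).2 (Or.inl ⟨i, hi, rfl⟩), ht⟩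
      · exact ⟨S (l + i), (mem_arr S _).2 (Or.inr ⟨i, hi, rfl⟩), ht⟩
    · rintro ⟨B, hB, ht⟩
      rcases (mem_arr S _).1 hB with ⟨i, hi, rfl⟩ | ⟨i, hi, rfl⟩
      · exact Or.inl ⟨i, hi, ht⟩
      · exact Or.inr ⟨i, hi, ht⟩

theorem list_sum_range (f : ℕ → ℝ) (m : ℕ) :
    ((List.range m).map f).sum = ∑ i ∈ Finset.range m, f i := by
  induction m with
  | zero => simp
  | succ m ih => simp [List.range_succ, Finset.sum_range_succ, ih]

theorem rev_sum (f : ℕ → ℝ) (l d : ℕ) (hd : d ≤ l) :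
    ∑ i ∈ Finset.range d, f (l - i) = ∑ i ∈ Finset.Icc 1 l, f i -
      ∑ i ∈ Finset.Icc 1 (l - d), f i := by
  induction d with
  | zero => simp
  | succ d ih =>
    rw [Finset.sum_range_succ, ih (by omega)]
    have : l - d = (l - (d + 1)) + 1 := by omega
    rw [this, Finset.sum_Icc_succ_top (by omega)]
    ring

theorem shift_sum (f : ℕ → ℝ) (b : ℕ) :
    ∑ i ∈ Finset.range b, f (1 + i) = ∑ i ∈ Finset.Icc 1 b, f i := by
  induction b with
  | zero => simp
  | succ b ih => rw [Finset.sum_range_succ, ih, Finset.sum_Icc_succ_top (by omega), add_comm 1 b]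

theorem take_sum1 {n l r : ℕ} {S : ℕ → Finset (Fin n)} (x : Fin n → ℝ)
    (h : (arrList n (l + r) l S).Pairwise Disjoint) (i : ℕ) (hi : i ≤ l) :
    ∑ j ∈ lUnion ((arrList n (l + r) l S).take i), x j =
      (∑ i ∈ Finset.Icc 1 l, ∑ j ∈ S i, x j) - ∑ i ∈ Finset.Icc 1 (l - i), ∑ j ∈ S i, x j := by
  rw [sum_lUnion x _ (h.sublist (List.take_sublist _ _)), arrList,
    List.take_append_of_le_length (by simpa using hi), ← List.map_take, List.take_range,
    List.map_map, Nat.min_eq_left (by omega), list_sum_range]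
  exact rev_sum (fun i => ∑ j ∈ S i, x j) l i hi

theorem take_sum2 {n l r : ℕ} {S : ℕ → Finset (Fin n)} (x : Fin n → ℝ)
    (h : (arrList n (l + r) l S).Pairwise Disjoint) (b : ℕ) (hb : b ≤ r) :
    ∑ j ∈ lUnion ((arrList n (l + r) l S).take (l + b)), x j =
      (∑ i ∈ Finset.Icc 1 l, ∑ j ∈ S i, x j) + ∑ i ∈ Finset.Icc 1 b, ∑ j ∈ S (l + i), x j := by
  rw [sum_lUnion x _ (h.sublist (List.take_sublist _ _)), arrList, List.take_append,
    List.take_of_length_le (by simp), ← List.map_take, List.take_range, List.map_append,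
    List.map_map, List.map_map, List.sum_append, list_sum_range, list_sum_range]
  congr 1
  · have := rev_sum (fun i => ∑ j ∈ S i, x j) l l le_rfl
    simpa using this
  · rw [← shift_sum (fun i => ∑ j ∈ S (l + i), x j)]
    have : min (l + b - (List.map (fun i => S (l - i)) (List.range l)).length) (l + r - l) = b := by
      simp; omega
    rw [this]
    simp [add_assoc]

theorem plate_arr {n l r : ℕ} {S : ℕ → Finset (Fin n)} (x : Fin n → ℝ)
    (h : IsOSP Finset.univ (arrList n (l + r) l S)) (hx : ∑ i, x i = 0) (Y V : ℕ → ℝ)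
    (hY : Y = fun a => ∑ i ∈ Finset.Icc 1 a, ∑ j ∈ S i, x j)
    (hV : V = fun b => ∑ i ∈ Finset.Icc 1 b, ∑ j ∈ S (l + i), x j) (htot : Y l + V r = 0) :
    x ∈ plate (arrList n (l + r) l S) ↔ (∀ a, 1 ≤ a → a < l → 0 ≤ Y l - Y a) ∧
      (∀ b ≤ r, 0 ≤ Y l + V b) := by
  obtain ⟨h1, h2, h3⟩ := h
  have t1 : ∀ i ≤ l, ∑ j ∈ lUnion ((arrList n (l + r) l S).take i), x j = Y l - Y (l - i) := by
    intro i hi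
    rw [take_sum1 x h2 i hi, hY]
  have t2 : ∀ b ≤ r, ∑ j ∈ lUnion ((arrList n (l + r) l S).take (l + b)), x j = Y l + V b := by
    intro b hb
    rw [take_sum2 x h2 b hb, hY, hV]
  have hlen : (arrList n (l + r) l S).length = l + r := by simp [arrList]
  constructor
  · rintro ⟨-, -, -, hp⟩
    rw [hlen] at hp
    constructor
    · intro a ha hal
      have := hp (l - a) (by omega) (by omega)
      rwa [t1 _ (by omega), Nat.sub_sub_self hal.le] at this
    · intro b hb
      rcases Nat.lt_or_ge b r with h | h
      · rcases Nat.eq_zero_or_pos (l + b) with h0 | h0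
        · have : l = 0 ∧ b = 0 := by omega
          rw [this.1, this.2]
          simp [hY, hV]
        · have := hp (l + b) h0 (by omega)
          rwa [t2 b hb] at this
      · obtain rfl : b = r := by omega
        exact htot.ge
  · rintro ⟨hA, hB⟩
    refine ⟨hx, by simp [h3], by rw [h3]; exact hx, ?_⟩
    intro i hi hil
    rw [hlen] at hil
    rcases Nat.lt_or_ge i l with h | h
    · rw [t1 i h.le]
      exact hA (l - i) (by omega) (by omega)
    · obtain ⟨b, rfl⟩ := Nat.exists_eq_add_of_le h
      rw [t2 b (by omega)]
      exact hB b (by omega)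

theorem wt_full {n : ℕ} (x : Fin n → ℝ) (L : List (Finset (Fin n)))
    (hL : lUnion L = Finset.univ) (hx : ∑ i, x i = 0) :
    wt x L = (-1) ^ L.length * ind (plate L) x := by
  have : (∀ i : ℕ, 0 < i → i ≤ L.length → 0 ≤ ∑ j ∈ lUnion (L.take i), x j) ↔ x ∈ plate L := by
    constructor
    · intro h
      exact ⟨hx, by simp [hL], by rw [hL]; exact hx, fun i h1 h2 => h i h1 h2.le⟩
    · rintro ⟨-, -, -, h⟩ i hi hiL
      rcases Nat.lt_or_ge i L.length with h' | h'
      · exact h i hi h'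
      · rw [List.take_of_length_le h', hL, hx]
  unfold wt ind
  rw [if_congr this rfl rfl]
  split_ifs <;> simp

/-- linear functional: sum over `T` -/
noncomputable def sumOn {n : ℕ} (T : Finset (Fin n)) : (Fin n → ℝ) →ₗ[ℝ] ℝ :=
  ∑ i ∈ T, LinearMap.proj i

theorem sumOn_apply {n : ℕ} (T : Finset (Fin n)) (x : Fin n → ℝ) :
    sumOn T x = ∑ i ∈ T, x i := by
  simp [sumOn, LinearMap.sum_apply]

theorem W_lt {n : ℕ} (T : Finset (Fin n)) (h1 : T.Nonempty) (h2 : T ≠ Finset.univ) :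
    V0 n ⊓ LinearMap.ker (sumOn T) < V0 n := by
  refine lt_of_le_of_ne inf_le_left fun h => ?_
  obtain ⟨i, hi⟩ := h1
  obtain ⟨j, hj⟩ : ∃ j, j ∉ T := by
    by_contra hc
    push Not at hc
    exact h2 (Finset.eq_univ_iff_forall.2 hc)
  have hv : (Pi.single i 1 - Pi.single j 1 : Fin n → ℝ) ∈ V0 n := by
    simp [V0, sumLin]
  rw [← h, Submodule.mem_inf, LinearMap.mem_ker, sumOn_apply] at hv
  have := hv.2
  simp [Finset.sum_sub_distrib, Finset.sum_pi_single, hi, hj] at this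

/-- straightening in the quotient `𝒫ⁿ`.  Let
`(S_l, S_{l−1},…,S₁,S_{l+1},…,S_k)` be an ordered set partition of `{1,…,n}`.  The
function `[[S_l,…,S₁,S_{l+1},…,S_k]] − ∑_π (−1)^{k−l−1−len(π)} [[π]]` vanishes outside a
finite union of proper linear subspaces of `V₀ⁿ` (in particular, Lebesgue-almost
everywhere on `V₀ⁿ`), where `π` ranges over the ordered set partitions described in
`QuotCond`. -/
theorem statement_14 (n k l : ℕ) (hl : 1 ≤ l) (hlk : l ≤ k)
    (S : ℕ → Finset (Fin n)) (hOSP : IsOSP Finset.univ (arrList n k l S)) :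
    ∃ (m : ℕ) (W : Fin m → Submodule ℝ (Fin n → ℝ)),
      (∀ j, W j < V0 n) ∧
      ∀ x : Fin n → ℝ, x ∈ V0 n → (∀ j, x ∉ W j) →
        ind (plate (arrList n k l S)) x -
          (∑ᶠ π ∈ {π : List (Finset (Fin n)) | QuotCond n k l S π},
            (-1 : ℚ) ^ ((k : ℤ) - (l : ℤ) - 1 - (π.length : ℤ)) * ind (plate π) x) = 0 := by
  obtain ⟨r, rfl⟩ := Nat.exists_eq_add_of_le hlk
  obtain ⟨hG, huniv⟩ := arr_good S hOSP
  let T := {T : Finset (Fin n) // T.Nonempty ∧ T ≠ Finset.univ}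
  let e := Fintype.equivFin T
  refine ⟨Fintype.card T, fun j => V0 n ⊓ LinearMap.ker (sumOn (e.symm j).1), ?_, ?_⟩
  · intro j
    exact W_lt _ (e.symm j).2.1 (e.symm j).2.2
  intro x hx hgen
  have hx0 : ∑ i, x i = 0 := hx
  have hgen' : ∀ B : Finset (Fin n), B.Nonempty → B ≠ Finset.univ → ∑ i ∈ B, x i ≠ 0 := by
    intro B h1 h2 h3
    apply hgen (e ⟨B, h1, h2⟩)
    rw [Submodule.mem_inf, LinearMap.mem_ker, sumOn_apply]
    simpa using ⟨hx, h3⟩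
  obtain ⟨Y, hY⟩ : ∃ Y : ℕ → ℝ, Y = fun a => ∑ i ∈ Finset.Icc 1 a, ∑ j ∈ S i, x j := ⟨_, rfl⟩
  obtain ⟨V, hV⟩ : ∃ V : ℕ → ℝ, V = fun b => ∑ i ∈ Finset.Icc 1 b, ∑ j ∈ S (l + i), x j :=
    ⟨_, rfl⟩
  have hsum : ∀ a b, a ≤ l → b ≤ r → ∑ j ∈ U l S a b, x j = Y a + V b := by
    intro a b ha hb
    rw [sum_U hG x ha hb, hY, hV]
  have htot : Y l + V r = 0 := by rw [← hsum l r le_rfl le_rfl, huniv, hx0]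
  have hfin := D_final l r hl (D l S x) Y V
    (fun a ha => by rw [D_row0 hG x ha, hsum _ _ ha (Nat.zero_le _)])
    (fun a b ha hb => by rw [D_row hG x ha hb, hsum _ _ ha hb])
    htot (fun a ha hal => by
      rw [← hsum a r hal.le le_rfl]
      apply hgen'
      · obtain ⟨t, ht⟩ := hG.ne a ha (by omega)
        exact ⟨t, (hG.mem1 hal.le le_rfl ha hal.le ht).2 le_rfl⟩
      · intro hc
        have := hG.U_inj hal.le le_rfl le_rfl le_rfl (hc.trans huniv.symm)
        omega)
  replace hfin : D l S x l r = (-1) ^ (r + 1) * ind (plate (arrList n (l + r) l S)) x := by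
    rw [hfin, ind]
    have hiff := plate_arr x hOSP hx0 Y V hY hV htot
    by_cases hc : x ∈ plate (arrList n (l + r) l S)
    · rw [if_pos hc, if_pos (hiff.1 hc)]
    · rw [if_neg hc, if_neg (fun h => hc (hiff.2 h))]
  have hset : {π : List (Finset (Fin n)) | QuotCond n (l + r) l S π} = ↑(A l S l r) := by
    ext L
    rw [Set.mem_setOf_eq, quot_iff hG hl huniv, Finset.mem_coe, mem_A]
  rw [hset, finsum_mem_coe_finset]
  have hterm : ∑ π ∈ A l S l r, (-1 : ℚ) ^ (((l + r : ℕ) : ℤ) - (l : ℤ) - 1 - (π.length : ℤ)) *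
      ind (plate π) x = (-1) ^ (r + 1) * D l S x l r := by
    rw [D, Finset.mul_sum]
    refine Finset.sum_congr rfl fun L hL => ?_
    rw [wt_full x L ((mem_A.1 hL).lUnion.trans huniv) hx0, ← mul_assoc]
    congr 1
    have e1 : (((l + r : ℕ) : ℤ) - (l : ℤ) - 1 - (L.length : ℤ)) =
        ((r + 1 + L.length : ℕ) : ℤ) + 2 * (-1 - (L.length : ℤ)) := by push_cast; ring
    rw [e1, zpow_add₀ (by norm_num), zpow_mul, zpow_natCast, pow_add]
    norm_num
  rw [hterm, hfin, ← mul_assoc, ← mul_pow]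
  simp

end PlatesPaper
end

section
/- Let {(i₁,j₁),…,(i_{n−1},j_{n−1})} be the edge set of a directed tree on the vertex set {1,…,n}. Then in the field of rational functions ℚ(x₁,…,xₙ) one has ∑_σ ∏_{a=1}^{n−1} 1/(x_{σ_a} − x_{σ_{a+1}}) = ∏_{k=1}^{n−1} 1/(x_{i_k} − x_{j_k}), where σ = (σ₁,…,σₙ) ranges over all permutations of (1,…,n) such that for every edge (i_k,j_k) the label i_k appears before j_k in σ. -/
open scoped Pointwise Classical

namespace PlatesPaper

/-- The root vector `e_{p.1} − e_{p.2}` of `ℝⁿ`. -/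
def rootVec (n : ℕ) (p : Fin n × Fin n) : Fin n → ℝ :=
  fun i => (if i = p.1 then 1 else 0) - (if i = p.2 then 1 else 0)

/-- The conical hull `⟨e_{i₁}−e_{j₁},…,e_{i_{n−1}}−e_{j_{n−1}}⟩₊`. -/
def treeCone (n : ℕ) (e : Fin (n - 1) → Fin n × Fin n) : Set (Fin n → ℝ) :=
  {x | ∃ c : Fin (n - 1) → ℝ, (∀ a, 0 ≤ c a) ∧ x = ∑ a, c a • rootVec n (e a)}

/-- The `n − 1` ordered pairs `e a` are the edges of a directed tree on `{1,…,n}`: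
the endpoints of each pair are distinct and the underlying undirected graph is a
tree (hence spanning). -/
def IsDirTree (n : ℕ) (e : Fin (n - 1) → Fin n × Fin n) : Prop :=
  (∀ a, (e a).1 ≠ (e a).2) ∧
  (SimpleGraph.fromRel fun u v => ∃ a, e a = (u, v)).IsTree

/-- The indeterminate `x_i`, viewed in the field of rational functions
`ℚ(x₁,…,xₙ) = Frac(ℚ[x₁,…,xₙ])`. -/
noncomputable def xv (n : ℕ) (i : Fin n) : FractionRing (MvPolynomial (Fin n) ℚ) :=
  algebraMap (MvPolynomial (Fin n) ℚ) _ (MvPolynomial.X i)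

section helpers

set_option linter.unusedSectionVars false

variable {V K : Type*} [DecidableEq V] [Field K]

/-- Product of inverse consecutive differences along a word. -/
def chainProd (x : V → K) : List V → K
  | [] => 1
  | [_] => 1
  | a :: b :: l => (x a - x b)⁻¹ * chainProd x (b :: l)

/-- `a` appears before `b`. -/
def Bef (a b : V) (w : List V) : Prop := w.idxOf a < w.idxOf b

theorem bef_cons (a b c : V) (w : List V) :
    Bef a b (c :: w) ↔ b ≠ c ∧ (a = c ∨ Bef a b w) := by
  unfold Bef
  by_cases h1 : c = a <;> by_cases h2 : c = b <;>
    simp [List.idxOf_cons, h1, h2, eq_comm] <;> grind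

theorem bef_insert (a b v : V) (ha : a ≠ v) (hb : b ≠ v) (w : List V) :
    ∀ w' ∈ List.permutations'Aux v w, (Bef a b w' ↔ Bef a b w) := by
  induction w with
  | nil => simp [bef_cons, ha, hb]
  | cons c l ih =>
    intro w' hw'
    simp only [List.permutations'Aux, List.mem_cons, List.mem_map] at hw'
    rcases hw' with rfl | ⟨t, ht, rfl⟩
    · rw [bef_cons]; simp [ha, hb]
    · rw [bef_cons, bef_cons _ _ _ l, ih t ht]

theorem sum_insert_after (x : V → K) (hx : Function.Injective x) (v : V) (l : List V) :
    ∀ a, a ≠ v → v ∉ l → (a :: l).Nodup →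
    ((List.permutations'Aux v l).map (fun w => chainProd x (a :: w))).sum
      = chainProd x (a :: l) * (x a - x v)⁻¹ := by
  induction l with
  | nil => intro a ha _ _; simp [chainProd]
  | cons b l ih =>
    intro a ha hv hn
    have hbv : b ≠ v := by grind
    have hab : a ≠ b := by grind
    have h := ih b hbv (by grind) (by grind)
    simp only [List.permutations'Aux, List.map_cons, List.sum_cons, List.map_map,
      Function.comp_def, chainProd, List.sum_map_mul_left]
    rw [h]
    have h1 : x a - x v ≠ 0 := sub_ne_zero.2 (hx.ne ha)
    have h2 : x b - x v ≠ 0 := sub_ne_zero.2 (hx.ne hbv)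
    have h2' : x v - x b ≠ 0 := sub_ne_zero.2 (hx.ne hbv.symm)
    have h3 : x a - x b ≠ 0 := sub_ne_zero.2 (hx.ne hab)
    have h4 : (x b - x v)⁻¹ = - (x v - x b)⁻¹ := by rw [← inv_neg, neg_sub]
    rw [h4]
    field_simp
    ring

theorem sum_insert_all (x : V → K) (hx : Function.Injective x) (v : V) (l : List V)
    (hl : l ≠ []) (hv : v ∉ l) (hn : l.Nodup) :
    ((List.permutations'Aux v l).map (fun w => chainProd x w)).sum = 0 := by
  cases l with
  | nil => exact absurd rfl hl
  | cons a l =>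
    have ha : a ≠ v := by grind
    simp only [List.permutations'Aux, List.map_cons, List.sum_cons, List.map_map,
      Function.comp_def]
    rw [sum_insert_after x hx v l a ha (by grind) hn]
    have h4 : (x a - x v)⁻¹ = - (x v - x a)⁻¹ := by rw [← inv_neg, neg_sub]
    rw [h4, chainProd]
    ring

theorem sum_insert_out (x : V → K) (hx : Function.Injective x) (u v : V) (l : List V) :
    u ∈ l → v ∉ l → l.Nodup →
    ((List.permutations'Aux v l).map (fun w => if Bef u v w then chainProd x w else 0)).sum
      = chainProd x l * (x u - x v)⁻¹ := by
  induction l with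
  | nil => intro h; simp at h
  | cons a l ih =>
    intro hu hv hn
    have huv : u ≠ v := by grind
    have hav : a ≠ v := by grind
    simp only [List.permutations'Aux, List.map_cons, List.sum_cons, List.map_map,
      Function.comp_def]
    rw [if_neg (by simp [bef_cons]), zero_add]
    by_cases hua : u = a
    · subst hua
      rw [← sum_insert_after x hx v l u huv (by grind) hn]
      simp [bef_cons, huv.symm]
    · have hul : u ∈ l := by grind
      have h := ih hul (by grind) (by grind)
      cases l with
      | nil => simp at hul
      | cons c l =>
        simp only [List.permutations'Aux, List.map_cons, List.sum_cons, List.map_map,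
          Function.comp_def] at h ⊢
        rw [if_neg (by simp [bef_cons]), zero_add] at h
        rw [if_neg (by simp [bef_cons, hua]), zero_add]
        rw [chainProd, mul_assoc, ← h, ← List.sum_map_mul_left]
        congr 1
        apply List.map_congr_left
        intro w _
        rw [bef_cons u v a]
        simp [hua, hav.symm, chainProd]

theorem bef_symm_iff (u v : V) (w : List V) (huv : u ≠ v) (hu : u ∈ w) :
    Bef v u w ↔ ¬ Bef u v w := by
  unfold Bef
  have : w.idxOf u ≠ w.idxOf v := by
    intro h
    exact huv ((List.idxOf_inj hu).1 h)
  omega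

theorem mem_of_mem_aux (v : V) (w w' : List V) (h : w' ∈ List.permutations'Aux v w) :
    List.Perm w' (v :: w) := by
  induction w generalizing w' with
  | nil => simp at h; subst h; rfl
  | cons c l ih =>
    simp only [List.permutations'Aux, List.mem_cons, List.mem_map] at h
    rcases h with rfl | ⟨t, ht, rfl⟩
    · rfl
    · exact ((ih t ht).cons c).trans (List.Perm.swap _ _ _)

theorem sum_insert_in (x : V → K) (hx : Function.Injective x) (u v : V) (l : List V)
    (hu : u ∈ l) (hv : v ∉ l) (hn : l.Nodup) :
    ((List.permutations'Aux v l).map (fun w => if Bef v u w then chainProd x w else 0)).sum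
      = chainProd x l * (x v - x u)⁻¹ := by
  have huv : u ≠ v := by grind
  have h1 := sum_insert_out x hx u v l hu hv hn
  have h2 := sum_insert_all x hx v l (by grind) hv hn
  have h3 : (List.permutations'Aux v l).map (fun w => chainProd x w) =
      (List.permutations'Aux v l).map (fun w => (if Bef u v w then chainProd x w else 0)
        + (if Bef v u w then chainProd x w else 0)) := by
    apply List.map_congr_left
    intro w hw
    have hm : u ∈ w := (mem_of_mem_aux v l w hw).mem_iff.2 (by simp [hu])
    rw [bef_symm_iff u v w huv hm]
    by_cases h : Bef u v w <;> simp [h]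
  rw [h3, List.sum_map_add, h1] at h2
  have h4 : (x v - x u)⁻¹ = - (x u - x v)⁻¹ := by rw [← inv_neg, neg_sub]
  rw [h4]
  linear_combination h2

/-- Trees grown leaf by leaf: vertex list and edge list. -/
inductive Grow : List V → List (V × V) → Prop
  | single (v : V) : Grow [v] []
  | out (L E u v) : Grow L E → u ∈ L → v ∉ L → Grow (v :: L) ((u, v) :: E)
  | inn (L E u v) : Grow L E → u ∈ L → v ∉ L → Grow (v :: L) ((v, u) :: E)

theorem Grow.inv {L : List V} {E : List (V × V)} (h : Grow L E) :
    L.Nodup ∧ E.Nodup ∧ L.length = E.length + 1 ∧ ∀ p ∈ E, p.1 ∈ L ∧ p.2 ∈ L := by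
  induction h with
  | single v => simp
  | out L E u v h hu hv ih =>
    obtain ⟨h1, h2, h3, h4⟩ := ih
    refine ⟨by simp [h1, hv], ?_, by simp [h3], ?_⟩
    · simp only [List.nodup_cons, h2, and_true]
      exact fun h => hv (h4 _ h).2
    · grind
  | inn L E u v h hu hv ih =>
    obtain ⟨h1, h2, h3, h4⟩ := ih
    refine ⟨by simp [h1, hv], ?_, by simp [h3], ?_⟩
    · simp only [List.nodup_cons, h2, and_true]
      exact fun h => hv (h4 _ h).1
    · grind

theorem grow_step (x : V → K) (L : List V) (E : List (V × V)) (v : V) (p : V × V)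
    (hv : v ∉ L) (hE : ∀ p ∈ E, p.1 ∈ L ∧ p.2 ∈ L)
    (hs : ∀ w : List V, w.Perm L →
      ((List.permutations'Aux v w).map
        (fun w => if Bef p.1 p.2 w then chainProd x w else 0)).sum
      = chainProd x w * (x p.1 - x p.2)⁻¹)
    (ih : (L.permutations'.map
      (fun w => if ∀ p ∈ E, Bef p.1 p.2 w then chainProd x w else 0)).sum
      = (E.map (fun p => (x p.1 - x p.2)⁻¹)).prod) :
    ((v :: L).permutations'.map
      (fun w => if ∀ q ∈ p :: E, Bef q.1 q.2 w then chainProd x w else 0)).sum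
      = ((p :: E).map (fun p => (x p.1 - x p.2)⁻¹)).prod := by
  rw [List.permutations', List.map_flatMap, List.flatMap_def, List.sum_flatten, List.map_map, List.map_cons, List.prod_cons, ← ih,
    ← List.sum_map_mul_left]
  congr 1
  apply List.map_congr_left
  intro w hw
  have hp := List.mem_permutations'.1 hw
  have key : ∀ w' ∈ List.permutations'Aux v w,
      ((∀ q ∈ E, Bef q.1 q.2 w') ↔ ∀ q ∈ E, Bef q.1 q.2 w) := by
    intro w' hw'
    refine forall₂_congr fun q hq => bef_insert _ _ v ?_ ?_ w w' hw'
    · rintro rfl; exact hv (hE q hq).1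
    · rintro rfl; exact hv (hE q hq).2
  by_cases hc : ∀ q ∈ E, Bef q.1 q.2 w
  · rw [if_pos hc, mul_comm, ← hs w hp]
    simp only [Function.comp_apply]
    congr 1
    apply List.map_congr_left
    intro w' hw'
    have := (key w' hw').2 hc
    have hiff : (∀ q ∈ p :: E, Bef q.1 q.2 w') ↔ Bef p.1 p.2 w' := by
      rw [List.forall_mem_cons]
      exact and_iff_left this
    by_cases hb : Bef p.1 p.2 w'
    · rw [if_pos hb, if_pos (hiff.2 hb)]
    · rw [if_neg hb, if_neg (fun h => hb (hiff.1 h))]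
  · rw [if_neg hc, mul_zero]
    apply List.sum_eq_zero
    intro y hy
    obtain ⟨w', hw', rfl⟩ := List.mem_map.1 hy
    rw [if_neg]
    intro h
    exact hc ((key w' hw').1 fun q hq => h q (List.mem_cons_of_mem _ hq))

theorem Grow.sum_eq (x : V → K) (hx : Function.Injective x) {L : List V} {E : List (V × V)}
    (h : Grow L E) :
    (L.permutations'.map
      (fun w => if ∀ p ∈ E, Bef p.1 p.2 w then chainProd x w else 0)).sum
      = (E.map (fun p => (x p.1 - x p.2)⁻¹)).prod := by
  induction h with
  | single v => simp [chainProd]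
  | out L E u v h hu hv ih =>
    refine grow_step x L E v (u, v) hv h.inv.2.2.2 (fun w hw => ?_) ih
    exact sum_insert_out x hx u v w (hw.mem_iff.2 hu) (fun h => hv (hw.mem_iff.1 h))
      (hw.nodup_iff.2 h.inv.1)
  | inn L E u v h hu hv ih =>
    refine grow_step x L E v (v, u) hv h.inv.2.2.2 (fun w hw => ?_) ih
    exact sum_insert_in x hx u v w (hw.mem_iff.2 hu) (fun h => hv (hw.mem_iff.1 h))
      (hw.nodup_iff.2 h.inv.1)

theorem exists_grow (m : ℕ) (e : Fin m → Fin (m + 1) × Fin (m + 1))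
    (hc : (SimpleGraph.fromRel fun u v => ∃ a, e a = (u, v)).Connected) (k : ℕ) (hk : k ≤ m) :
    ∃ L E, Grow L E ∧ L.length = k + 1 ∧ ∀ p ∈ E, ∃ a, e a = p := by
  induction k with
  | zero => exact ⟨[0], [], .single 0, rfl, by simp⟩
  | succ k ih =>
    obtain ⟨L, E, hg, hl, hE⟩ := ih (by omega)
    obtain ⟨s, hs⟩ : ∃ s, s ∈ L := List.exists_mem_of_length_pos (by omega)
    obtain ⟨t, ht⟩ : ∃ t, t ∉ L := by
      by_contra! hcon
      have h1 : (Finset.univ : Finset (Fin (m + 1))) ⊆ L.toFinset := fun t _ => by simp [hcon t]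
      have h2 := (Finset.card_le_card h1).trans (List.toFinset_card_le L)
      simp at h2
      omega
    obtain ⟨w⟩ := hc.preconnected s t
    obtain ⟨d, _, hd1, hd2⟩ := w.exists_boundary_dart {z | z ∈ L} hs ht
    have had := d.adj
    rw [SimpleGraph.fromRel_adj] at had
    rcases had.2 with h | h
    · exact ⟨_, _, .out L E _ _ hg hd1 hd2, by simp [hl], by
        simpa only [List.forall_mem_cons] using ⟨h, hE⟩⟩
    · exact ⟨_, _, .inn L E _ _ hg hd1 hd2, by simp [hl], by
        simpa only [List.forall_mem_cons] using ⟨h, hE⟩⟩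

theorem chainProd_ofFn (x : V → K) (m : ℕ) (g : Fin (m + 1) → V) :
    chainProd x (List.ofFn g) = ∏ a : Fin m, (x (g a.castSucc) - x (g a.succ))⁻¹ := by
  induction m with
  | zero => simp [chainProd]
  | succ m ih =>
    have := ih (fun i => g i.succ)
    rw [Fin.prod_univ_succ, List.ofFn_succ, List.ofFn_succ, chainProd]
    rw [List.ofFn_succ] at this
    rw [this]
    simp

theorem idxOf_ofFn (n : ℕ) (σ : Equiv.Perm (Fin n)) (a : Fin n) :
    (List.ofFn σ).idxOf a = (σ.symm a : ℕ) := by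
  have hn : (List.ofFn σ).Nodup := List.nodup_ofFn.2 σ.injective
  have h := hn.idxOf_getElem (σ.symm a : ℕ) (by simp)
  simpa using h

theorem sum_perm (n : ℕ) (L : List (Fin n)) (hL : L.Nodup) (hl : L.length = n)
    (F : List (Fin n) → K) :
    ∑ σ : Equiv.Perm (Fin n), F (List.ofFn σ) = (L.permutations'.map F).sum := by
  rw [← List.sum_toFinset F ((List.permutations_perm_permutations' L).nodup_iff.1 (List.nodup_permutations L hL))]
  have hfull : ∀ w : List (Fin n), w.Nodup → w.length = n → ∀ a, a ∈ w := by
    intro w hw hlw a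
    have : w.toFinset = Finset.univ := by
      rw [← Finset.card_eq_iff_eq_univ, List.toFinset_card_of_nodup hw, hlw]; simp
    rw [← List.mem_toFinset, this]; simp
  refine Finset.sum_bij (fun σ _ => List.ofFn σ) ?_ ?_ ?_ ?_
  · intro σ _
    have hn : (List.ofFn σ).Nodup := List.nodup_ofFn.2 σ.injective
    rw [List.mem_toFinset, List.mem_permutations', List.perm_ext_iff_of_nodup hn hL]
    intro a
    exact iff_of_true (hfull _ hn (by simp) a) (hfull _ hL hl a)
  · intro σ _ τ _ h
    exact DFunLike.coe_injective (List.ofFn_injective h)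
  · intro w hw
    rw [List.mem_toFinset, List.mem_permutations'] at hw
    have hn := hw.nodup_iff.2 hL
    have hlw : w.length = n := hw.length_eq.trans hl
    have hinj : Function.Injective (fun i : Fin n => w.get (i.cast hlw.symm)) := by
      intro i j h
      have := List.nodup_iff_injective_get.1 hn h
      simpa using this
    refine ⟨Equiv.ofBijective _ (Finite.injective_iff_bijective.1 hinj), Finset.mem_univ _, ?_⟩
    apply List.ext_getElem
    · simp [hlw]
    · intro i h1 h2
      simp
  · intro σ _
    rfl

end helpers


/-- For a directed tree with edges `(i_k, j_k)` on `{1,…,n}`, in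
`ℚ(x₁,…,xₙ)` one has
`∑_σ ∏_{a=1}^{n−1} 1/(x_{σ_a} − x_{σ_{a+1}}) = ∏_{k=1}^{n−1} 1/(x_{i_k} − x_{j_k})`,
where `σ` ranges over the permutations of `(1,…,n)` such that for every edge `i_k`
appears before `j_k` in the one-line word of `σ`. -/
theorem statement_18 (n : ℕ) (e : Fin (n - 1) → Fin n × Fin n) (he : IsDirTree n e) :
    ∑ σ ∈ Finset.univ.filter (fun σ : Equiv.Perm (Fin n) =>
        ∀ a : Fin (n - 1), σ.symm (e a).1 < σ.symm (e a).2),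
      ∏ a : Fin (n - 1),
        (xv n (σ ⟨a.1, by have := a.isLt; omega⟩) -
         xv n (σ ⟨a.1 + 1, by have := a.isLt; omega⟩))⁻¹ =
    ∏ a : Fin (n - 1), (xv n (e a).1 - xv n (e a).2)⁻¹ := by
  cases n with
  | zero => exact absurd he.2.1.nonempty (by rintro ⟨i⟩; exact i.elim0)
  | succ m =>
    have hx : Function.Injective (xv (m + 1)) := by
      intro i j h
      exact MvPolynomial.X_injective (IsFractionRing.injective (MvPolynomial (Fin (m + 1)) ℚ)
        (FractionRing (MvPolynomial (Fin (m + 1)) ℚ)) h)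
    obtain ⟨L, E, hg, hl, hE⟩ := exists_grow m e he.2.1 m le_rfl
    obtain ⟨hL, hEn, hlen, -⟩ := hg.inv
    have hperm : E.Perm (List.ofFn (n := m) e) := by
      refine (List.subperm_of_subset hEn ?_).perm_of_length_le (by simp; omega)
      intro p hp
      obtain ⟨a, ha⟩ := hE p hp
      exact (List.mem_ofFn' _ _).2 ⟨a, ha⟩
    have hmain := hg.sum_eq (xv (m + 1)) hx
    rw [← sum_perm (m + 1) L hL hl, (hperm.map _).prod_eq, List.map_ofFn, List.prod_ofFn] at hmain
    rw [Finset.sum_filter]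
    refine Eq.trans (Finset.sum_congr rfl fun σ _ => ?_) hmain
    rw [chainProd_ofFn]
    have hiff : (∀ a : Fin m, σ.symm (e a).1 < σ.symm (e a).2) ↔
        ∀ p ∈ E, Bef p.1 p.2 (List.ofFn σ) := by
      unfold Bef
      simp only [idxOf_ofFn, hperm.mem_iff]
      constructor
      · intro h p hp
        obtain ⟨a, rfl⟩ := (List.mem_ofFn' _ _).1 hp
        exact h a
      · intro h a
        exact h (e a) ((List.mem_ofFn' _ _).2 ⟨a, rfl⟩)
    by_cases hc : ∀ a : Fin m, σ.symm (e a).1 < σ.symm (e a).2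
    · rw [if_pos (hiff.1 hc)]
      exact if_pos hc
    · rw [if_neg (fun h => hc (hiff.2 h))]
      exact if_neg hc

end PlatesPaper
end

section
/- Let {(i₁,j₁),…,(i_{n−1},j_{n−1})} be the edge set of a directed tree on the vertex set {1,…,n}. Then in the field of rational functions ℚ(x₁,…,xₙ) one has ∑_σ ∏_{a=1}^{n−1} 1/(1 − x_{σ_a}/x_{σ_{a+1}}) = ∏_{k=1}^{n−1} 1/(1 − x_{i_k}/x_{j_k}), where σ = (σ₁,…,σₙ) ranges over all permutations of (1,…,n) such that for every edge (i_k,j_k) the label i_k appears before j_k in σ. -/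
open scoped Pointwise Classical

namespace PlatesPaper

/-- Connectedness: every rational function constant along edges is constant. -/
def CC {m : ℕ} (e : Fin m → Fin (m + 1) × Fin (m + 1)) : Prop :=
  ∀ f : Fin (m + 1) → ℚ, (∀ a, f (e a).1 = f (e a).2) → ∀ u v, f u = f v

/-- `σ` is a linear extension of `e`. -/
def Ext {m : ℕ} (e : Fin m → Fin (m + 1) × Fin (m + 1)) (σ : Equiv.Perm (Fin (m + 1))) : Prop :=
  ∀ a, σ.symm (e a).1 < σ.symm (e a).2

lemma CC.surj {m : ℕ} {e : Fin m → Fin (m + 1) × Fin (m + 1)} (h : CC e) (c : Fin m → ℚ) :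
    ∃ f : Fin (m + 1) → ℚ, ∀ a, f (e a).2 - f (e a).1 = c a := by
  let D : (Fin (m + 1) → ℚ) →ₗ[ℚ] (Fin m → ℚ) :=
    { toFun := fun f a => f (e a).2 - f (e a).1
      map_add' := by intro f g; ext a; simp; ring
      map_smul' := by intro r f; ext a; simp; ring }
  have hk : LinearMap.ker D ≤ Submodule.span ℚ {(fun _ => 1 : Fin (m + 1) → ℚ)} := by
    intro f hf
    have hf' : D f = 0 := hf
    rw [Submodule.mem_span_singleton]
    refine ⟨f 0, ?_⟩
    ext v
    have := h f (fun a => by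
      have := congrFun hf' a
      simp only [D, LinearMap.coe_mk, AddHom.coe_mk, Pi.zero_apply] at this
      linarith) 0 v
    simpa using this
  have h1 := Submodule.finrank_mono hk
  have h2 : Module.finrank ℚ (Submodule.span ℚ {(fun _ => 1 : Fin (m + 1) → ℚ)}) ≤ 1 :=
    (finrank_span_le_card _).trans (by simp)
  have h3 := LinearMap.finrank_range_add_finrank_ker D
  have h4 : LinearMap.range D = ⊤ := by
    apply Submodule.eq_top_of_finrank_eq
    have := Submodule.finrank_le (LinearMap.range D)
    simp only [Module.finrank_fintype_fun_eq_card, Fintype.card_fin] at *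
    omega
  obtain ⟨f, hf⟩ := LinearMap.range_eq_top.1 h4 c
  exact ⟨f, fun a => congrFun hf a⟩

lemma CC.exists_ext {m : ℕ} {e : Fin m → Fin (m + 1) × Fin (m + 1)} (h : CC e) :
    ∃ σ, Ext e σ := by
  obtain ⟨f, hf⟩ := h.surj (fun _ => 1)
  refine ⟨Tuple.sort f, fun a => ?_⟩
  by_contra hc
  have := Tuple.monotone_sort f (not_lt.1 hc)
  simp only [Function.comp, Equiv.apply_symm_apply] at this
  have := hf a
  linarith

lemma CC.ne {m : ℕ} {e : Fin m → Fin (m + 1) × Fin (m + 1)} (h : CC e) (a : Fin m) :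
    (e a).1 ≠ (e a).2 := by
  obtain ⟨f, hf⟩ := h.surj (fun _ => 1)
  intro hc
  have := hf a
  rw [hc] at this
  simp at this

lemma CC.ne_tgt {m : ℕ} {e : Fin m → Fin (m + 1) × Fin (m + 1)} (h : CC e) {a b : Fin m}
    (hab : a ≠ b) (hs : (e a).1 = (e b).1) : (e a).2 ≠ (e b).2 := by
  obtain ⟨f, hf⟩ := h.surj (fun c => if c = a then 1 else 0)
  intro hc
  have h1 := hf a
  have h2 := hf b
  rw [if_pos rfl] at h1
  rw [if_neg (Ne.symm hab)] at h2
  rw [hc, hs] at h1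
  linarith

lemma CC.ne_src {m : ℕ} {e : Fin m → Fin (m + 1) × Fin (m + 1)} (h : CC e) {a b : Fin m}
    (hab : a ≠ b) (hs : (e a).2 = (e b).2) : (e a).1 ≠ (e b).1 :=
  fun hc => h.ne_tgt hab hc hs

/-- In a path, consecutive positions. -/
lemma ext_path {m : ℕ} {e : Fin m → Fin (m + 1) × Fin (m + 1)}
    (h1 : Function.Injective fun a => (e a).1) (h2 : Function.Injective fun a => (e a).2)
    {σ : Equiv.Perm (Fin (m + 1))} (hσ : Ext e σ) :
    ∃ p : Equiv.Perm (Fin m), ∀ a, σ (p a).castSucc = (e a).1 ∧ σ (p a).succ = (e a).2 := by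
  have hs : ∀ a, (σ.symm (e a).1).val < m := fun a => by
    have := hσ a; have := (σ.symm (e a).2).isLt; omega
  have ht : ∀ a, 0 < (σ.symm (e a).2).val := fun a => by
    have := hσ a; omega
  let p : Fin m → Fin m := fun a => ⟨(σ.symm (e a).1).val, hs a⟩
  let q : Fin m → Fin m := fun a => ⟨(σ.symm (e a).2).val - 1, by
    have := (σ.symm (e a).2).isLt; have := ht a; omega⟩
  have hp : Function.Injective p := by
    intro a b hab
    apply h1
    apply σ.symm.injective
    apply Fin.ext
    simpa [p] using hab
  have hq : Function.Injective q := by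
    intro a b hab
    apply h2
    apply σ.symm.injective
    apply Fin.ext
    have := congrArg Fin.val hab
    have := ht a
    have := ht b
    simp only [q] at *
    omega
  have hpb := Finite.injective_iff_bijective.1 hp
  have hqb := Finite.injective_iff_bijective.1 hq
  have hsum : ∑ a, (p a).val = ∑ a, (q a).val := by
    rw [hpb.sum_comp (fun i : Fin m => i.val), hqb.sum_comp (fun i : Fin m => i.val)]
  have hle : ∀ a ∈ Finset.univ, (p a).val ≤ (q a).val := fun a _ => by
    have := hσ a
    simp only [p, q]
    omega
  have heq := (Finset.sum_eq_sum_iff_of_le hle).1 hsum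
  refine ⟨Equiv.ofBijective p hpb, fun a => ?_⟩
  constructor
  · rw [← Equiv.eq_symm_apply]
    rfl
  · rw [← Equiv.eq_symm_apply]
    apply Fin.ext
    have h3 := heq a (Finset.mem_univ a)
    have := ht a
    simp only [Equiv.ofBijective_apply, Fin.val_succ]
    simp only [p, q] at *
    omega

lemma ext_unique {m : ℕ} {e : Fin m → Fin (m + 1) × Fin (m + 1)} (h : CC e)
    (h1 : Function.Injective fun a => (e a).1) (h2 : Function.Injective fun a => (e a).2)
    {σ τ : Equiv.Perm (Fin (m + 1))} (hσ : Ext e σ) (hτ : Ext e τ) : σ = τ := by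
  have key : ∀ ρ : Equiv.Perm (Fin (m + 1)), Ext e ρ →
      ∀ a, ((ρ.symm (e a).2).val : ℚ) = (ρ.symm (e a).1).val + 1 := by
    intro ρ hρ a
    obtain ⟨p, hp⟩ := ext_path h1 h2 hρ
    rw [← (hp a).1, ← (hp a).2]
    simp
  have hc := h (fun v => ((σ.symm v).val : ℚ) - (τ.symm v).val) (fun a => by
    have := key σ hσ a; have := key τ hτ a; linarith)
  have h0 : ∀ v, ((σ.symm v).val : ℚ) - (τ.symm v).val = 0 := by
    intro v
    have ha := hc v (σ 0)
    have hb := hc v (τ 0)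
    simp only [Equiv.symm_apply_apply, Fin.val_zero, Nat.cast_zero] at ha hb
    have : (0 : ℚ) ≤ ((τ.symm (σ 0)).val : ℚ) := by positivity
    have : (0 : ℚ) ≤ ((σ.symm (τ 0)).val : ℚ) := by positivity
    linarith
  have : σ.symm = τ.symm := by
    ext v
    have := h0 v
    have h' : ((σ.symm v).val : ℚ) = (τ.symm v).val := by linarith
    exact_mod_cast h'
  simpa using congrArg Equiv.symm this

section
variable {K : Type*} [Field K]

/-- Left summand. -/
noncomputable def Wt {m : ℕ} (x : Fin (m + 1) → K) (σ : Equiv.Perm (Fin (m + 1))) : K :=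
  ∏ a : Fin m, (1 - x (σ a.castSucc) / x (σ a.succ))⁻¹

/-- Right-hand side. -/
noncomputable def Rt {m : ℕ} (x : Fin (m + 1) → K) (e : Fin m → Fin (m + 1) × Fin (m + 1)) : K :=
  ∏ a : Fin m, (1 - x (e a).1 / x (e a).2)⁻¹

lemma three_src {a b c : K} (hb : b ≠ 0) (hc : c ≠ 0) (hab : a ≠ b) (hac : a ≠ c)
    (hbc : b ≠ c) : (1 - a / b)⁻¹ * (1 - a / c)⁻¹ =
      (1 - a / b)⁻¹ * (1 - b / c)⁻¹ + (1 - c / b)⁻¹ * (1 - a / c)⁻¹ := by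
  rw [one_sub_div hb, one_sub_div hc, one_sub_div hc, one_sub_div hb]
  simp only [inv_div]
  have h1 := sub_ne_zero.2 hab.symm
  have h2 := sub_ne_zero.2 hac.symm
  have h3 := sub_ne_zero.2 hbc.symm
  have h4 : b - c = -(c - b) := by ring
  rw [h4, div_neg]
  field_simp
  ring

lemma three_tgt {a b c : K} (ha : a ≠ 0) (hb : b ≠ 0) (hc : c ≠ 0) (hab : a ≠ b) (hac : a ≠ c)
    (hbc : b ≠ c) : (1 - b / a)⁻¹ * (1 - c / a)⁻¹ =
      (1 - b / c)⁻¹ * (1 - c / a)⁻¹ + (1 - b / a)⁻¹ * (1 - c / b)⁻¹ := by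
  rw [one_sub_div ha, one_sub_div ha, one_sub_div hc, one_sub_div hb]
  simp only [inv_div]
  have h1 := sub_ne_zero.2 hab
  have h2 := sub_ne_zero.2 hac
  have h3 := sub_ne_zero.2 hbc.symm
  have h4 : b - c = -(c - b) := by ring
  rw [h4, div_neg]
  field_simp
  ring

lemma Rt_split {m : ℕ} (x : Fin (m + 1) → K) (e : Fin m → Fin (m + 1) × Fin (m + 1))
    {a b : Fin m} (hab : a ≠ b) :
    Rt x e = ((1 - x (e a).1 / x (e a).2)⁻¹ * (1 - x (e b).1 / x (e b).2)⁻¹) *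
      ∏ c ∈ (Finset.univ.erase a).erase b, (1 - x (e c).1 / x (e c).2)⁻¹ := by
  unfold Rt
  rw [← Finset.mul_prod_erase Finset.univ _ (Finset.mem_univ a),
    ← Finset.mul_prod_erase (Finset.univ.erase a) _
      (Finset.mem_erase.2 ⟨hab.symm, Finset.mem_univ b⟩), mul_assoc]

lemma Rt_rest {m : ℕ} (x : Fin (m + 1) → K) (e e' : Fin m → Fin (m + 1) × Fin (m + 1))
    {a b : Fin m} (h : ∀ c, c ≠ a → c ≠ b → e c = e' c) :
    ∏ c ∈ (Finset.univ.erase a).erase b, (1 - x (e c).1 / x (e c).2)⁻¹ =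
    ∏ c ∈ (Finset.univ.erase a).erase b, (1 - x (e' c).1 / x (e' c).2)⁻¹ := by
  apply Finset.prod_congr rfl
  intro c hc
  simp only [Finset.mem_erase] at hc
  rw [h c hc.2.1 hc.1]

/-- The existence of a splitting of a tree which is not a path. -/
lemma exists_split {m : ℕ} (x : Fin (m + 1) → K) (hx : Function.Injective x) (hx0 : ∀ i, x i ≠ 0)
    (e : Fin m → Fin (m + 1) × Fin (m + 1)) (h : CC e)
    (hn : ¬ (Function.Injective (fun a => (e a).1) ∧ Function.Injective fun a => (e a).2)) :
    ∃ e₁ e₂ : Fin m → Fin (m + 1) × Fin (m + 1), CC e₁ ∧ CC e₂ ∧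
      (∀ σ, Ext e σ ↔ Ext e₁ σ ∨ Ext e₂ σ) ∧ (∀ σ, Ext e₁ σ → ¬ Ext e₂ σ) ∧
      Rt x e = Rt x e₁ + Rt x e₂ := by
  rw [not_and_or] at hn
  rcases hn with hn | hn
  · simp only [Function.Injective, not_forall] at hn
    obtain ⟨a, b, hs, hab⟩ := hn
    have hvw := h.ne_tgt hab hs
    have ha := h.ne a
    have hb := h.ne b
    have hba : b ≠ a := Ne.symm hab
    refine ⟨Function.update e b ((e a).2, (e b).2), Function.update e a ((e b).2, (e a).2),
      ?_, ?_, ?_, ?_, ?_⟩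
    · intro f hf
      apply h f
      intro c
      have h1 := hf a
      have h2 := hf b
      have h3 := hf c
      by_cases hc : c = b
      · subst hc; simp [hab] at h1 h2; rw [← hs, h1, h2]
      · simpa [hc] using h3
    · intro f hf
      apply h f
      intro c
      have h1 := hf a
      have h2 := hf b
      have h3 := hf c
      by_cases hc : c = a
      · subst hc; simp [hba] at h1 h2; rw [hs, h2, h1]
      · simpa [hc] using h3
    · intro σ
      constructor
      · intro hσ
        rcases lt_or_gt_of_ne (σ.symm.injective.ne hvw) with hl | hl
        · left
          intro c
          by_cases hc : c = b
          · subst hc; simpa using hl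
          · simpa [hc] using hσ c
        · right
          intro c
          by_cases hc : c = a
          · subst hc; simpa using hl
          · simpa [hc] using hσ c
      · rintro (hσ | hσ) c
        · have h1 := hσ a
          have h2 := hσ b
          have h3 := hσ c
          by_cases hc : c = b
          · subst hc; simp [hab] at h1 h2; rw [← hs]; exact h1.trans h2
          · simpa [hc] using h3
        · have h1 := hσ a
          have h2 := hσ b
          have h3 := hσ c
          by_cases hc : c = a
          · subst hc; simp [hba] at h1 h2; rw [hs]; exact h2.trans h1
          · simpa [hc] using h3
    · intro σ h1 h2
      have h1 := h1 b
      have h2 := h2 a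
      simp at h1 h2
      exact lt_asymm h1 h2
    · rw [Rt_split x e hab, Rt_split x (Function.update e b ((e a).2, (e b).2)) hab,
        Rt_split x (Function.update e a ((e b).2, (e a).2)) hab,
        Rt_rest x (Function.update e b ((e a).2, (e b).2)) e (fun c _ hc => by simp [hc]),
        Rt_rest x (Function.update e a ((e b).2, (e a).2)) e (fun c hc _ => by simp [hc]),
        ← add_mul]
      congr 1
      simp only [Function.update_self, Function.update_of_ne hab, Function.update_of_ne hba]
      rw [← hs] at hb ⊢
      exact three_src (hx0 _) (hx0 _) (hx.ne ha) (hx.ne hb) (hx.ne hvw)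
  · simp only [Function.Injective, not_forall] at hn
    obtain ⟨a, b, hs, hab⟩ := hn
    have hvw := h.ne_src hab hs
    have ha := h.ne a
    have hb := h.ne b
    have hba : b ≠ a := Ne.symm hab
    refine ⟨Function.update e a ((e a).1, (e b).1), Function.update e b ((e b).1, (e a).1),
      ?_, ?_, ?_, ?_, ?_⟩
    · intro f hf
      apply h f
      intro c
      have h1 := hf a
      have h2 := hf b
      have h3 := hf c
      by_cases hc : c = a
      · subst hc; simp [hba] at h1 h2; rw [hs, h1, h2]
      · simpa [hc] using h3
    · intro f hf
      apply h f
      intro c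
      have h1 := hf a
      have h2 := hf b
      have h3 := hf c
      by_cases hc : c = b
      · subst hc; simp [hab] at h1 h2; rw [← hs, h2, h1]
      · simpa [hc] using h3
    · intro σ
      constructor
      · intro hσ
        rcases lt_or_gt_of_ne (σ.symm.injective.ne hvw) with hl | hl
        · left
          intro c
          by_cases hc : c = a
          · subst hc; simpa using hl
          · simpa [hc] using hσ c
        · right
          intro c
          by_cases hc : c = b
          · subst hc; simpa using hl
          · simpa [hc] using hσ c
      · rintro (hσ | hσ) c
        · have h1 := hσ a
          have h2 := hσ b
          have h3 := hσ c
          by_cases hc : c = a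
          · subst hc; simp [hba] at h1 h2; rw [hs]; exact h1.trans h2
          · simpa [hc] using h3
        · have h1 := hσ a
          have h2 := hσ b
          have h3 := hσ c
          by_cases hc : c = b
          · subst hc; simp [hab] at h1 h2; rw [← hs]; exact h2.trans h1
          · simpa [hc] using h3
    · intro σ h1 h2
      have h1 := h1 a
      have h2 := h2 b
      simp at h1 h2
      exact lt_asymm h1 h2
    · rw [Rt_split x e hab, Rt_split x (Function.update e a ((e a).1, (e b).1)) hab,
        Rt_split x (Function.update e b ((e b).1, (e a).1)) hab,
        Rt_rest x (Function.update e a ((e a).1, (e b).1)) e (fun c hc _ => by simp [hc]),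
        Rt_rest x (Function.update e b ((e b).1, (e a).1)) e (fun c _ hc => by simp [hc]),
        ← add_mul]
      congr 1
      simp only [Function.update_self, Function.update_of_ne hab, Function.update_of_ne hba]
      rw [← hs] at hb ⊢
      exact three_tgt (hx0 _) (hx0 _) (hx0 _) (hx.ne ha.symm) (hx.ne hb.symm) (hx.ne hvw)

lemma main_aux {m : ℕ} (x : Fin (m + 1) → K) (hx : Function.Injective x) (hx0 : ∀ i, x i ≠ 0) :
    ∀ (N : ℕ) (e : Fin m → Fin (m + 1) × Fin (m + 1)), CC e →
      (Finset.univ.filter (Ext e)).card = N →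
      ∑ σ ∈ Finset.univ.filter (Ext e), Wt x σ = Rt x e := by
  intro N
  induction N using Nat.strong_induction_on with
  | _ N ih =>
    intro e h hN
    by_cases hn : Function.Injective (fun a => (e a).1) ∧ Function.Injective fun a => (e a).2
    · obtain ⟨σ, hσ⟩ := h.exists_ext
      have hf : Finset.univ.filter (Ext e) = {σ} := by
        ext τ
        simp only [Finset.mem_filter, Finset.mem_univ, true_and, Finset.mem_singleton]
        exact ⟨fun hτ => ext_unique h hn.1 hn.2 hτ hσ, fun hτ => hτ ▸ hσ⟩
      rw [hf, Finset.sum_singleton]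
      obtain ⟨p, hp⟩ := ext_path hn.1 hn.2 hσ
      unfold Wt Rt
      rw [← Equiv.prod_comp p]
      apply Finset.prod_congr rfl
      intro a _
      rw [(hp a).1, (hp a).2]
    · obtain ⟨e₁, e₂, c₁, c₂, hor, hdis, hR⟩ := exists_split x hx hx0 e h hn
      have hu : Finset.univ.filter (Ext e) =
          Finset.univ.filter (Ext e₁) ∪ Finset.univ.filter (Ext e₂) := by
        ext σ
        simp [hor]
      have hd : Disjoint (Finset.univ.filter (Ext e₁)) (Finset.univ.filter (Ext e₂)) := by
        rw [Finset.disjoint_filter]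
        intro σ _
        exact hdis σ
      have p₁ : 0 < (Finset.univ.filter (Ext e₁)).card := by
        obtain ⟨σ, hσ⟩ := c₁.exists_ext
        exact Finset.card_pos.2 ⟨σ, by simpa using hσ⟩
      have p₂ : 0 < (Finset.univ.filter (Ext e₂)).card := by
        obtain ⟨σ, hσ⟩ := c₂.exists_ext
        exact Finset.card_pos.2 ⟨σ, by simpa using hσ⟩
      have hcard := Finset.card_union_of_disjoint hd
      rw [← hu] at hcard
      rw [hu, Finset.sum_union hd, ih _ (by omega) e₁ c₁ rfl, ih _ (by omega) e₂ c₂ rfl, hR]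

end

lemma CC_of_tree {m : ℕ} {e : Fin m → Fin (m + 1) × Fin (m + 1)} (he : IsDirTree (m + 1) e) :
    CC e := by
  intro f hf u v
  obtain ⟨w⟩ := he.2.connected.preconnected u v
  induction w with
  | nil => rfl
  | cons hadj _ ih =>
    rw [← ih]
    rw [SimpleGraph.fromRel_adj] at hadj
    rcases hadj.2 with ⟨a, ha⟩ | ⟨a, ha⟩
    · have := hf a
      rw [ha] at this
      exact this
    · have := hf a
      rw [ha] at this
      exact this.symm

lemma xv_inj (n : ℕ) : Function.Injective (xv n) := by
  intro i j h
  exact MvPolynomial.X_injective (IsFractionRing.injective _ _ h)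

lemma xv_ne (n : ℕ) (i : Fin n) : xv n i ≠ 0 := by
  intro h
  have := (IsFractionRing.injective (MvPolynomial (Fin n) ℚ) _) (h.trans (map_zero _).symm)
  exact MvPolynomial.X_ne_zero i this

/-- For a directed tree with edges `(i_k, j_k)` on `{1,…,n}`, in
`ℚ(x₁,…,xₙ)` one has
`∑_σ ∏_{a=1}^{n−1} 1/(1 − x_{σ_a}/x_{σ_{a+1}}) = ∏_{k=1}^{n−1} 1/(1 − x_{i_k}/x_{j_k})`,
where `σ` ranges over the permutations of `(1,…,n)` such that for every edge `i_k`
appears before `j_k` in the one-line word of `σ`. -/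
theorem statement_19 (n : ℕ) (e : Fin (n - 1) → Fin n × Fin n) (he : IsDirTree n e) :
    ∑ σ ∈ Finset.univ.filter (fun σ : Equiv.Perm (Fin n) =>
        ∀ a : Fin (n - 1), σ.symm (e a).1 < σ.symm (e a).2),
      ∏ a : Fin (n - 1),
        (1 - xv n (σ ⟨a.1, by have := a.isLt; omega⟩) /
             xv n (σ ⟨a.1 + 1, by have := a.isLt; omega⟩))⁻¹ =
    ∏ a : Fin (n - 1), (1 - xv n (e a).1 / xv n (e a).2)⁻¹ := by
  cases n with
  | zero => exact (he.2.connected.nonempty.some).elim0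
  | succ m =>
    have key := main_aux (xv (m + 1)) (xv_inj _) (xv_ne _) _ e (CC_of_tree he) rfl
    refine Eq.trans (Finset.sum_congr ?_ fun σ _ => rfl) key
    ext σ
    simp only [Finset.mem_filter, Finset.mem_univ, true_and]
    exact Iff.rfl

end PlatesPaper
end
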